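/- arXiv:1402.7091 — 2 statements merged into one kernel-verified Lean document; each statement's English description precedes it below -/
import Mathlib

section
/- The character of the type B_n highest weight module with highest weight Λ = (p/2)Σ e_i factors as e^{pθ} times the sum of Schur polynomials over partitions with all parts at most p: D_{ρ+pθ}/D_ρ = (x_1⋯x_n)^{−p/2} Σ_{λ : λ_1' ≤ ... parts ≤ p} s_λ(x_1,...,x_n), where x_i = e^{−e_i}. Equivalently (Macdonald's identity): Σ_{w ∈ S_n⋉(Z/2)^n} ε(w) e^{w(ρ+pθ)} / Σ_w ε(w) e^{w(ρ)} = (x_1⋯x_n)^{−p/2} Σ_{λ ⊆ (p^n), all parts ≤ p} s_λ(x). -/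
/-!
STATEMENT 13 (Macdonald's identity / character of the B_n HW module V^{pθ}):
Σ_{w ∈ W} ε(w) e^{w(ρ+pθ)} = (x_1⋯x_n)^{−p/2} (Σ_{λ ⊆ (p^n)} s_λ(x)) · Σ_{w ∈ W} ε(w) e^{wρ},
where W = S_n ⋉ (Z/2)^n, ρ = ½Σ(2n−2i+1)e_i, θ = ½Σe_i and x_i = e^{−e_i}.

Since ρ has half-integral coordinates we work in the group algebra
ℤ[½ℤ^n] ≅ AddMonoidAlgebra ℤ (Fin n → ℤ) using DOUBLED weights: the basis
element of exponent v represents e^{(1/2)Σ v_i e_i}.  Thus x_i = e^{−e_i} is the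
monomial with doubled weight −2e_i, doubled ρ is (2n−2i−1)_i (0-indexed), and
doubled ρ + pθ adds p to each coordinate.  The identity is stated multiplied
through by D_ρ.  Schur polynomials are defined by Jacobi–Trudi and evaluated at
the monomials x_i.
-/

open MvPolynomial

noncomputable def hpoly (n k : ℕ) : MvPolynomial (Fin n) ℤ :=
  ∑ d ∈ Finset.Nat.antidiagonalTuple n k, ∏ i, MvPolynomial.X i ^ d i

noncomputable def hInt (n : ℕ) (k : ℤ) : MvPolynomial (Fin n) ℤ :=
  if 0 ≤ k then hpoly n k.toNat else 0

noncomputable def schur (n : ℕ) (lam : ℕ → ℕ) : MvPolynomial (Fin n) ℤ :=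
  if lam n = 0 then
    Matrix.det (Matrix.of fun i j : Fin n => hInt n ((lam i : ℤ) + j - i))
  else 0

def extN {n : ℕ} (f : Fin n → ℕ) : ℕ → ℕ := fun i => if h : i < n then f ⟨i, h⟩ else 0

/-- The group algebra of the (doubled) weight lattice ℤ^n. -/
abbrev WtAlg (n : ℕ) : Type := AddMonoidAlgebra ℤ (Fin n → ℤ)

/-- The action of the signed permutation w = σ τ_I on a (doubled) weight vector:
(w ν) i = ε(σ⁻¹ i) · ν (σ⁻¹ i). -/
def sAct {n : ℕ} (σ : Equiv.Perm (Fin n)) (I : Finset (Fin n)) (ν : Fin n → ℤ) :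
    Fin n → ℤ := fun i => (if σ⁻¹ i ∈ I then -1 else 1) * ν (σ⁻¹ i)

/-- The Weyl alternant D_ν = Σ_{w ∈ W} ε(w) e^{wν} (in doubled weights),
W = S_n ⋉ (Z/2)^n ranging over pairs (σ, I). -/
noncomputable def weylAlt (n : ℕ) (ν : Fin n → ℤ) : WtAlg n :=
  ∑ σ : Equiv.Perm (Fin n), ∑ I : Finset (Fin n),
    AddMonoidAlgebra.single (sAct σ I ν)
      (((Equiv.Perm.sign σ : ℤˣ) : ℤ) * (-1) ^ I.card)

/-- The monomial x_i = e^{−e_i} (doubled weight −2e_i). -/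
noncomputable def xMon {n : ℕ} (i : Fin n) : WtAlg n :=
  AddMonoidAlgebra.single (fun j => if j = i then -2 else 0) 1

/-- Doubled Weyl vector of so_{2n+1}: 2ρ_i = 2n − 2i − 1 (0-indexed). -/
def rho2 (n : ℕ) : Fin n → ℤ := fun i => 2 * (n : ℤ) - 2 * (i : ℤ) - 1

theorem sum_one_sub_mul_prod_div_sub {ι F : Type*} [DecidableEq ι] [Field F]
    (s : Finset ι) (x : ι → F) (hx : Set.InjOn x s) (hneg : ∀ i ∈ s, x i ≠ -1) :
    ∑ i ∈ s, (1 - x i) * ∏ j ∈ s.erase i, (1 - x i * x j) / (x j - x i) =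
      1 - ∏ i ∈ s, x i := by
  classical
  let v : Option ι → F := fun o => o.elim (-1) x
  let P : Polynomial F := ∏ j ∈ s, (1 - Polynomial.C (x j) * Polynomial.X)
  have hdeg1 : ∀ j ∈ s, (1 - Polynomial.C (x j) * Polynomial.X : Polynomial F).natDegree ≤ 1 := by
    intro j _
    compute_degree
  have hinj : Set.InjOn v (Finset.insertNone s) := by
    intro a ha b hb hab
    cases a with
    | none => cases b with
      | none => rfl
      | some b => exact absurd hab.symm (hneg b (by simpa using hb))
    | some a => cases b with
      | none => exact absurd hab (hneg a (by simpa using ha))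
      | some b => rw [hx (by simpa using ha) (by simpa using hb) hab]
  have hdeg : P.natDegree ≤ s.card := by
    refine (Polynomial.natDegree_prod_le _ _).trans ?_
    simpa using Finset.sum_le_sum hdeg1
  have hlt : P.degree < (Finset.insertNone s).card := by
    rw [Finset.card_insertNone]
    exact (Polynomial.natDegree_le_iff_degree_le.1 hdeg).trans_lt (by exact_mod_cast Nat.lt_succ_self _)
  have hcoeff : P.coeff s.card = ∏ j ∈ s, (-x j) := by
    have := Polynomial.coeff_prod_of_natDegree_le s
      (fun j => (1 - Polynomial.C (x j) * Polynomial.X : Polynomial F)) 1 hdeg1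
    simp only [mul_one] at this
    rw [this]
    refine Finset.prod_congr rfl fun j _ => ?_
    simp [Polynomial.coeff_one]
  have key := Lagrange.coeff_eq_sum hinj hlt
  have e1 : ∀ i, (Finset.insertNone s).erase (some i) = Finset.insertNone (s.erase i) := by
    intro i; ext a; cases a <;> simp
  have e2 : (Finset.insertNone s).erase none = s.map Function.Embedding.some := by
    ext a; cases a <;> simp
  have hP : ∀ z, P.eval z = ∏ j ∈ s, (1 - x j * z) := by
    intro z; simp [P, Polynomial.eval_prod]
  rw [Finset.card_insertNone, Nat.add_sub_cancel, hcoeff, Finset.sum_insertNone, e2,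
    Finset.prod_map] at key
  simp only [e1, hP, Finset.prod_insertNone, v, Option.elim, Function.Embedding.some_apply] at key
  have hs : ((-1 : F) ^ s.card) ^ 2 = 1 := by rw [← pow_mul, mul_comm, pow_mul]; simp
  have f1 : (∏ j ∈ s, (1 - x j * -1)) / ∏ j ∈ s, (-1 - x j) = (-1) ^ s.card := by
    rw [← Finset.prod_div_distrib, ← Finset.prod_const]
    refine Finset.prod_congr rfl fun j hj => ?_
    have : -1 - x j ≠ 0 := fun h => hneg j hj (by linear_combination -h)
    field_simp
    ring
  have f2 : ∀ i ∈ s, (∏ j ∈ s, (1 - x j * x i)) / ((x i - -1) * ∏ j ∈ s.erase i, (x i - x j)) =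
      -(-1) ^ s.card * ((1 - x i) * ∏ j ∈ s.erase i, (1 - x i * x j) / (x j - x i)) := by
    intro i hi
    have h1 : x i - -1 ≠ 0 := fun h => hneg i hi (by linear_combination h)
    have h2 : ∏ j ∈ s.erase i, (1 - x i * x j) / (x j - x i) =
        (-1) ^ (s.erase i).card *
          ((∏ j ∈ s.erase i, (1 - x j * x i)) / ∏ j ∈ s.erase i, (x i - x j)) := by
      rw [← Finset.prod_div_distrib, ← Finset.prod_const, ← Finset.prod_mul_distrib]
      refine Finset.prod_congr rfl fun j _ => ?_
      rw [← neg_sub (x i) (x j), div_neg]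
      ring
    have h3 : (-1 : F) ^ s.card = -(-1) ^ (s.erase i).card := by
      rw [← Finset.card_erase_add_one hi, pow_succ]; ring
    have h4 : ((-1 : F) ^ (s.erase i).card) ^ 2 = 1 := by
      rw [← pow_mul, mul_comm, pow_mul]; simp
    rw [h2, h3, ← Finset.mul_prod_erase s _ hi, mul_div_mul_comm]
    have h5 : (1 - x i * x i) / (x i - -1) = 1 - x i := by
      field_simp
      ring
    rw [h5]
    linear_combination (-(1 - x i) * ((∏ j ∈ s.erase i, (1 - x j * x i)) /
      ∏ j ∈ s.erase i, (x i - x j))) * h4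
  rw [f1, Finset.sum_congr rfl f2, ← Finset.mul_sum, Finset.prod_neg] at key
  linear_combination ((-1 : F) ^ s.card) * key + (1 - ∏ i ∈ s, x i -
    ∑ i ∈ s, (1 - x i) * ∏ j ∈ s.erase i, (1 - x i * x j) / (x j - x i)) * hs

/-- The product of the differences `x i - x j` over `i < j`. -/
def diffProd {R : Type*} [CommRing R] {n : ℕ} (x : Fin n → R) : R :=
  ∏ i, ∏ j ∈ Finset.Ioi i, (x i - x j)

/-- The product of all `1 - x i` and of all `1 - x i * x j` over `i < j`. -/
def typeBDenom {R : Type*} [CommRing R] {n : ℕ} (x : Fin n → R) : R :=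
  (∏ i, (1 - x i)) * ∏ i, ∏ j ∈ Finset.Ioi i, (1 - x i * x j)

theorem prod_prod_Ioi_succAbove {M : Type*} [CommMonoid M] {n : ℕ}
    (f : Fin (n + 1) → Fin (n + 1) → M) (i : Fin (n + 1)) :
    ∏ k, ∏ l ∈ Finset.Ioi k, f k l =
      (∏ j, if i.succAbove j < i then f (i.succAbove j) i else f i (i.succAbove j)) *
        ∏ k, ∏ l ∈ Finset.Ioi k, f (i.succAbove k) (i.succAbove l) := by
  have h : ∀ (m : ℕ) (g : Fin m → Fin m → M), ∏ k, ∏ l ∈ Finset.Ioi k, g k l =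
      ∏ k, ∏ l, if k < l then g k l else 1 := by
    intro m g
    refine Finset.prod_congr rfl fun k _ => ?_
    rw [← Finset.prod_filter]
    refine Finset.prod_congr ?_ fun _ _ => rfl
    ext; simp
  rw [h, h, Fin.prod_univ_succAbove _ i, Fin.prod_univ_succAbove _ i]
  simp_rw [fun k => Fin.prod_univ_succAbove (fun l => if i.succAbove k < l
    then f (i.succAbove k) l else 1) i]
  rw [Finset.prod_mul_distrib, ← mul_assoc, if_neg (lt_irrefl i), one_mul,
    ← Finset.prod_mul_distrib]
  congr 1
  · refine Finset.prod_congr rfl fun j _ => ?_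
    rcases lt_or_gt_of_ne (Fin.succAbove_ne i j) with h | h
    · simp [h, h.not_gt]
    · simp [h, h.not_gt]
  · simp [Fin.succAbove_lt_succAbove_iff]

theorem typeBDenom_succAbove {R : Type*} [CommRing R] {n : ℕ} (x : Fin (n + 1) → R)
    (i : Fin (n + 1)) :
    typeBDenom x = ((1 - x i) * ∏ j, (1 - x i * x (i.succAbove j))) *
      typeBDenom (fun j => x (i.succAbove j)) := by
  rw [typeBDenom, typeBDenom, prod_prod_Ioi_succAbove _ i, Fin.prod_univ_succAbove _ i]
  have : ∀ j, (if i.succAbove j < i then 1 - x (i.succAbove j) * x i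
      else 1 - x i * x (i.succAbove j)) = 1 - x i * x (i.succAbove j) := by
    intro j
    rw [mul_comm, ite_self]
  simp_rw [this]
  ring

theorem prod_ite_succAbove_lt_neg_one {R : Type*} [CommRing R] {n : ℕ} (i : Fin (n + 1)) :
    ∏ j, (if i.succAbove j < i then (-1 : R) else 1) = (-1) ^ (i : ℕ) := by
  rw [Finset.prod_ite, Finset.prod_const, Finset.prod_const_one, mul_one]
  congr 1
  simp_rw [Fin.succAbove_lt_iff_castSucc_lt, Fin.lt_def, Fin.val_castSucc]
  rw [Fin.card_filter_val_lt]
  have := i.2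
  omega

theorem diffProd_succAbove {R : Type*} [CommRing R] {n : ℕ} (x : Fin (n + 1) → R)
    (i : Fin (n + 1)) :
    diffProd x = (-1) ^ (i : ℕ) * (∏ j, (x i - x (i.succAbove j))) *
      diffProd (fun j => x (i.succAbove j)) := by
  rw [diffProd, diffProd, prod_prod_Ioi_succAbove _ i, ← prod_ite_succAbove_lt_neg_one i]
  congr 1
  rw [← Finset.prod_mul_distrib]
  refine Finset.prod_congr rfl fun j _ => ?_
  split_ifs <;> ring

theorem det_pow_rev {R : Type*} [CommRing R] {n : ℕ} (x : Fin n → R) :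
    (Matrix.of fun i j : Fin n => x i ^ (j.rev : ℕ)).det = diffProd x := by
  have := Matrix.det_projVandermonde (fun _ => 1) x
  simp only [one_mul] at this
  rw [diffProd, ← this]
  congr 1
  ext i j
  simp [Matrix.projVandermonde_apply]

theorem sum_sum_succAbove_true {M : Type*} [AddCommMonoid M] {n : ℕ}
    (F : Fin (n + 1) → (Fin n → Bool) → M) :
    ∑ i, ∑ b, F i b =
      ∑ b : Fin (n + 1) → Bool, ∑ i with b i, F i (fun j => b (i.succAbove j)) := by
  simp_rw [Finset.sum_filter]
  refine Eq.trans ?_ Finset.sum_comm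
  refine Finset.sum_congr rfl fun i _ => ?_
  rw [← (Fin.insertNthEquiv (fun _ => Bool) i).sum_comp, Fintype.sum_prod_type, Fintype.sum_bool]
  simp [Fin.insertNthEquiv]

/-- Invert the coordinates of `x` selected by `b`. -/
def flipInv {F : Type*} [Field F] {n : ℕ} (x : Fin n → F) (b : Fin n → Bool) : Fin n → F :=
  fun i => if b i then (x i)⁻¹ else x i

/-- The determinant `det (x_i ^ (n-1-j) - x_i ^ (q+n-1+j))` as a sum over sign changes. -/
def signedSum {F : Type*} [Field F] {n : ℕ} (q : ℕ) (x : Fin n → F) : F :=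
  ∑ b : Fin n → Bool, (∏ i, if b i then -x i ^ (q + 2 * n - 2) else 1) * diffProd (flipInv x b)

/-- The matrix with entries `x_i ^ (n-1-j) - x_i ^ (q+n-1+j)`. -/
def typeBMatrix {R : Type*} [CommRing R] {n : ℕ} (q : ℕ) (x : Fin n → R) :
    Matrix (Fin n) (Fin n) R :=
  Matrix.of fun i j => x i ^ (j.rev : ℕ) - x i ^ (q + 2 * n - 2 - j.rev)

theorem det_typeBMatrix {F : Type*} [Field F] {n : ℕ} (q : ℕ) (x : Fin n → F)
    (hx : ∀ i, x i ≠ 0) : (typeBMatrix q x).det = signedSum q x := by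
  let r : Fin n → Bool → Fin n → F := fun i β j =>
    (if β then -x i ^ (q + 2 * n - 2) else 1) *
      (if β then (x i)⁻¹ else x i) ^ (j.rev : ℕ)
  have h1 : typeBMatrix q x = Matrix.of fun i => ∑ β, r i β := by
    ext i j
    have hj : (j.rev : ℕ) ≤ q + 2 * n - 2 := by have := j.rev.2; have := j.2; omega
    simp only [typeBMatrix, Matrix.of_apply, r, Fintype.sum_bool, Pi.add_apply, if_true,
      Bool.false_eq_true, if_false, pow_sub₀ _ (hx i) hj]
    rw [inv_pow]
    ring
  rw [h1]
  change Matrix.detRowAlternating.toMultilinearMap (fun i => ∑ β, r i β) = _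
  rw [MultilinearMap.map_sum, signedSum]
  refine Finset.sum_congr rfl fun b _ => ?_
  rw [← det_pow_rev, ← Matrix.det_mul_column]
  rfl

theorem signedSum_zero {F : Type*} [Field F] {n : ℕ} (x : Fin (n + 1) → F)
    (hx : ∀ i, x i ≠ 0) : signedSum 0 x = 0 := by
  rw [← det_typeBMatrix _ _ hx]
  refine Matrix.det_eq_zero_of_column_eq_zero 0 fun i => ?_
  simp only [typeBMatrix, Matrix.of_apply, Fin.rev_zero, Fin.val_last]
  rw [show 0 + 2 * (n + 1) - 2 - n = n by omega, sub_self]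

/-- The conditions under which the partial fraction expansions make sense. -/
structure IsGeneric {F : Type*} [Field F] {n : ℕ} (x : Fin n → F) : Prop where
  ne_zero : ∀ i, x i ≠ 0
  ne_neg_one : ∀ i, x i ≠ -1
  injective : Function.Injective x

theorem IsGeneric.succAbove {F : Type*} [Field F] {n : ℕ} {x : Fin (n + 1) → F}
    (hx : IsGeneric x) (i : Fin (n + 1)) : IsGeneric fun j => x (i.succAbove j) where
  ne_zero _ := hx.ne_zero _
  ne_neg_one _ := hx.ne_neg_one _
  injective := hx.injective.comp Fin.succAbove_right_injective

theorem signedSum_summand_succAbove {F : Type*} [Field F] {n : ℕ} (q : ℕ) {x : Fin (n + 1) → F}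
    (hx : IsGeneric x) (b : Fin (n + 1) → Bool) (i : Fin (n + 1)) (hi : b i) :
    (-1) ^ (i : ℕ) * x i ^ (n + q) * ((1 - x i) * ∏ j, (1 - x i * x (i.succAbove j))) *
      ((∏ j, if b (i.succAbove j) then -x (i.succAbove j) ^ (q + 1 + 2 * n - 2) else 1) *
        diffProd (flipInv (fun j => x (i.succAbove j)) fun j => b (i.succAbove j))) =
    -((∏ j, if b j then -x j ^ (q + 2 * (n + 1) - 2) else 1) * diffProd (flipInv x b)) *
      ((1 - x i) * ∏ j ∈ (Finset.univ.filter fun j => b j).erase i,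
        (1 - x i * x j) / (x j - x i)) := by
  have hprod : ∏ j ∈ (Finset.univ.filter fun j => b j).erase i,
      (1 - x i * x j) / (x j - x i) = ∏ j, if b (i.succAbove j) then
        (1 - x i * x (i.succAbove j)) / (x (i.succAbove j) - x i) else 1 := by
    rw [← Finset.filter_ne', Finset.filter_filter, Finset.prod_filter, Fin.prod_univ_succAbove _ i]
    simp [Fin.succAbove_ne]
  rw [hprod, diffProd_succAbove (flipInv x b) i, Fin.prod_univ_succAbove _ i, if_pos hi]
  have hflip : (fun j => flipInv x b (i.succAbove j)) =
      flipInv (fun j => x (i.succAbove j)) fun j => b (i.succAbove j) := rfl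
  rw [hflip]
  generalize diffProd (flipInv (fun j => x (i.succAbove j)) fun j => b (i.succAbove j)) = D
  have hterm : (∏ j, (1 - x i * x (i.succAbove j))) *
      (∏ j, if b (i.succAbove j) then -x (i.succAbove j) ^ (q + 1 + 2 * n - 2) else 1) =
      x i ^ n * ((∏ j, if b (i.succAbove j) then
          -x (i.succAbove j) ^ (q + 2 * (n + 1) - 2) else 1) *
        (∏ j, (flipInv x b i - flipInv x b (i.succAbove j))) *
        ∏ j, if b (i.succAbove j) then
          (1 - x i * x (i.succAbove j)) / (x (i.succAbove j) - x i) else 1) := by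
    have hc : x i ^ n = ∏ _j : Fin n, x i := by simp
    rw [hc]
    simp_rw [← Finset.prod_mul_distrib]
    refine Finset.prod_congr rfl fun j _ => ?_
    have hxi := hx.ne_zero i
    have hxj := hx.ne_zero (i.succAbove j)
    have hd : x (i.succAbove j) - x i ≠ 0 :=
      sub_ne_zero.2 (hx.injective.ne (Fin.succAbove_ne i j))
    have hn : q + 2 * (n + 1) - 2 = (q + 1 + 2 * n - 2) + 1 := by
      have := j.2; omega
    rw [hn, pow_succ]
    simp only [flipInv, hi, if_true]
    split_ifs with hb
    · field_simp
    · field_simp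
  have hpow : x i ^ (q + 2 * (n + 1) - 2) = x i ^ (n + q) * x i ^ n := by
    rw [← pow_add]; congr 1; omega
  rw [hpow]
  linear_combination ((-1) ^ (i : ℕ) * x i ^ (n + q) * (1 - x i) * D) * hterm

theorem signedSum_succ {F : Type*} [Field F] {n : ℕ} (q : ℕ) {x : Fin (n + 1) → F}
    (hx : IsGeneric x) :
    signedSum (q + 1) x = signedSum q x + ∑ i : Fin (n + 1), (-1) ^ (i : ℕ) * x i ^ (n + q) *
      ((1 - x i) * ∏ j, (1 - x i * x (i.succAbove j))) *
        signedSum (q + 1) (fun j => x (i.succAbove j)) := by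
  simp_rw [signedSum, Finset.mul_sum]
  rw [sum_sum_succAbove_true, ← Finset.sum_add_distrib]
  refine Finset.sum_congr rfl fun b _ => ?_
  rw [Finset.sum_congr rfl fun i hi =>
      signedSum_summand_succAbove q hx b i (Finset.mem_filter.1 hi).2,
    ← Finset.mul_sum, sum_one_sub_mul_prod_div_sub _ _ hx.injective.injOn
      fun i _ => hx.ne_neg_one i]
  have : (∏ i, if b i then -x i ^ (q + 1 + 2 * (n + 1) - 2) else 1) =
      (∏ i, if b i then -x i ^ (q + 2 * (n + 1) - 2) else 1) *
        ∏ i with b i, x i := by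
    rw [Finset.prod_filter, ← Finset.prod_mul_distrib]
    refine Finset.prod_congr rfl fun i _ => ?_
    rw [show q + 1 + 2 * (n + 1) - 2 = q + 2 * (n + 1) - 2 + 1 by omega, pow_succ]
    split_ifs <;> ring
  rw [this]
  ring

/-- The sum over partitions `f` with at most `n` parts, all less than `q`, of the alternants
`det (x_i ^ (f_j + n - 1 - j))`. -/
def alternantSum {R : Type*} [CommRing R] {n : ℕ} (q : ℕ) (x : Fin n → R) : R :=
  ∑ f : {f : Fin n → Fin q // Antitone f},
    (Matrix.of fun i j : Fin n => x i ^ ((f.1 j : ℕ) + j.rev)).det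

theorem antitone_cons_last {n q : ℕ} {f : Fin n → Fin (q + 1)} (hf : Antitone f) :
    Antitone (Fin.cons (Fin.last q) f : Fin (n + 1) → Fin (q + 1)) := by
  intro i j hij
  cases i using Fin.cases with
  | zero => exact Fin.le_last _
  | succ i => cases j using Fin.cases with
    | zero => exact absurd hij (by simp)
    | succ j => exact hf (Fin.succ_le_succ_iff.1 hij)

/-- An antitone tuple either stays below the maximal value or starts with it. -/
def antitoneSumEquiv (n q : ℕ) :
    {f : Fin (n + 1) → Fin q // Antitone f} ⊕ {f : Fin n → Fin (q + 1) // Antitone f} ≃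
      {f : Fin (n + 1) → Fin (q + 1) // Antitone f} where
  toFun := Sum.elim
    (fun f => ⟨fun i => (f.1 i).castSucc, fun _ _ h => Fin.castSucc_le_castSucc_iff.2 (f.2 h)⟩)
    (fun f => ⟨Fin.cons (Fin.last q) f.1, antitone_cons_last f.2⟩)
  invFun f := if h : f.1 0 = Fin.last q then Sum.inr ⟨fun i => f.1 i.succ,
      fun _ _ hij => f.2 (Fin.succ_le_succ_iff.2 hij)⟩
    else Sum.inl ⟨fun i => (f.1 i).castPred fun hi => h (le_antisymm (Fin.le_last _)
      (hi ▸ f.2 (Fin.zero_le i))), fun _ _ hij => Fin.castPred_le_castPred_iff.2 (f.2 hij)⟩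
  left_inv f := by
    rcases f with f | f
    · simp [Fin.castSucc_ne_last]
    · simp
  right_inv f := by
    by_cases h : f.1 0 = Fin.last q
    · simp only [h, dite_true, Sum.elim_inr]
      ext i : 2
      cases i using Fin.cases <;> simp [h]
    · simp [h]

theorem alternantSum_succ {R : Type*} [CommRing R] {n : ℕ} (q : ℕ) (x : Fin (n + 1) → R) :
    alternantSum (q + 1) x = alternantSum q x + ∑ i : Fin (n + 1), (-1) ^ (i : ℕ) * x i ^ (n + q) *
      alternantSum (q + 1) (fun j => x (i.succAbove j)) := by
  rw [alternantSum, ← (antitoneSumEquiv n q).sum_comp, Fintype.sum_sum_type]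
  congr 1
  simp_rw [alternantSum, Finset.mul_sum]
  rw [Finset.sum_comm]
  refine Finset.sum_congr rfl fun f _ => ?_
  rw [Matrix.det_succ_column_zero]
  refine Finset.sum_congr rfl fun i _ => ?_
  congr 1
  · simp [antitoneSumEquiv, add_comm]
  · congr 1
    ext k l
    simp [antitoneSumEquiv]

theorem alternantSum_mul_typeBDenom {F : Type*} [Field F] {n : ℕ} (q : ℕ) (x : Fin n → F)
    (hx : IsGeneric x) : alternantSum q x * typeBDenom x = signedSum q x := by
  induction n generalizing q with
  | zero =>
    have : Unique {f : Fin 0 → Fin q // Antitone f} :=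
      ⟨⟨⟨Fin.elim0, fun i => i.elim0⟩⟩, fun f => Subtype.ext (Subsingleton.elim _ _)⟩
    simp [alternantSum, typeBDenom, signedSum, diffProd]
  | succ n ih =>
    induction q with
    | zero =>
      have : IsEmpty {f : Fin (n + 1) → Fin 0 // Antitone f} := ⟨fun f => (f.1 0).elim0⟩
      rw [signedSum_zero x hx.ne_zero]
      simp [alternantSum]
    | succ q ihq =>
      rw [alternantSum_succ, signedSum_succ q hx, add_mul, ihq, Finset.sum_mul]
      congr 1
      refine Finset.sum_congr rfl fun i _ => ?_
      rw [← ih (q + 1) _ (hx.succAbove i), typeBDenom_succAbove x i]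
      ring

theorem alternantSum_one {R : Type*} [CommRing R] {n : ℕ} (x : Fin n → R) :
    alternantSum 1 x = diffProd x := by
  have : Unique {f : Fin n → Fin 1 // Antitone f} :=
    ⟨⟨⟨fun _ => 0, fun _ _ _ => le_rfl⟩⟩, fun f => Subtype.ext (Subsingleton.elim _ _)⟩
  rw [alternantSum, Fintype.sum_unique, ← det_pow_rev]
  simp

/-- The complete homogeneous symmetric polynomial evaluated at `x`, zero in negative degree. -/
def hEval {R : Type*} [CommRing R] {n : ℕ} (x : Fin n → R) (k : ℤ) : R :=
  if 0 ≤ k then ∑ d ∈ Finset.Nat.antidiagonalTuple n k.toNat, ∏ i, x i ^ d i else 0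

theorem hEval_zero {R : Type*} [CommRing R] {n : ℕ} (x : Fin n → R) : hEval x 0 = 1 := by
  simp [hEval, Finset.Nat.antidiagonalTuple_zero_right]

theorem mk_hEval {R : Type*} [CommRing R] {n : ℕ} (x : Fin n → R) :
    PowerSeries.mk (fun k => hEval x k) = ∏ i, PowerSeries.mk fun k => x i ^ k := by
  ext k
  rw [PowerSeries.coeff_prod, PowerSeries.coeff_mk, hEval, if_pos (Int.natCast_nonneg k),
    Int.toNat_natCast]
  refine (Finset.sum_equiv Finsupp.equivFunOnFinite ?_ ?_).symm
  · intro d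
    simp [Finset.mem_finsuppAntidiag, Finset.Nat.mem_antidiagonalTuple]
  · intro d _
    simp

theorem mk_pow_mul_one_sub {R : Type*} [CommRing R] (a : R) :
    PowerSeries.mk (fun k => a ^ k) * (1 - PowerSeries.C a * PowerSeries.X) = 1 := by
  ext k
  rw [mul_sub, mul_one, mul_left_comm, map_sub, PowerSeries.coeff_C_mul, PowerSeries.coeff_mk]
  cases k with
  | zero => simp
  | succ k => simp [PowerSeries.coeff_one, pow_succ, mul_comm]

/-- The polynomial `∏ (1 - x_l t)` over `l ≠ k`. -/
noncomputable def elemErase {R : Type*} [CommRing R] {n : ℕ} (x : Fin n → R) (k : Fin n) :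
    Polynomial R :=
  ∏ l ∈ Finset.univ.erase k, (1 - Polynomial.C (x l) * Polynomial.X)

theorem natDegree_elemErase_lt {R : Type*} [CommRing R] {n : ℕ} (x : Fin n → R) (k : Fin n) :
    (elemErase x k).natDegree < n := by
  have h : (elemErase x k).natDegree ≤ n - 1 := by
    refine (Polynomial.natDegree_prod_le _ _).trans ?_
    have : ∀ l ∈ Finset.univ.erase k,
        (1 - Polynomial.C (x l) * Polynomial.X : Polynomial R).natDegree ≤ 1 := by
      intro l _
      compute_degree
    simpa using Finset.sum_le_sum this
  have := k.2
  omega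

theorem mk_hEval_mul_elemErase {R : Type*} [CommRing R] {n : ℕ} (x : Fin n → R) (k : Fin n) :
    (elemErase x k : PowerSeries R) * PowerSeries.mk (fun m => hEval x m) =
      PowerSeries.mk fun m => x k ^ m := by
  have h : (elemErase x k : PowerSeries R) =
      ∏ l ∈ Finset.univ.erase k, (1 - PowerSeries.C (x l) * PowerSeries.X) := by
    rw [elemErase, ← Polynomial.coeToPowerSeries.ringHom_apply, map_prod]
    simp
  rw [mk_hEval, ← Finset.mul_prod_erase _ _ (Finset.mem_univ k), h, mul_left_comm,
    ← Finset.prod_mul_distrib, Finset.prod_eq_one, mul_one]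
  intro l _
  rw [mul_comm, mk_pow_mul_one_sub]

theorem sum_hEval_mul_coeff_elemErase {R : Type*} [CommRing R] {n : ℕ} (x : Fin n → R)
    (k : Fin n) (a : ℕ) :
    ∑ j : Fin n, hEval x ((a : ℤ) - (j.rev : ℕ)) * (elemErase x k).coeff j.rev = x k ^ a := by
  rw [← Equiv.sum_comp Fin.revPerm]
  simp only [Fin.revPerm_apply, Fin.rev_rev]
  rw [Fin.sum_univ_eq_sum_range (fun d => hEval x ((a : ℤ) - (d : ℕ)) * (elemErase x k).coeff d)]
  have h := congrArg (PowerSeries.coeff a) (mk_hEval_mul_elemErase x k)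
  rw [PowerSeries.coeff_mul, PowerSeries.coeff_mk,
    Finset.Nat.sum_antidiagonal_eq_sum_range_succ_mk] at h
  rw [← h]
  have h1 : ∀ m : ℕ, m ≤ n + a + 1 → (n ≤ m ∨ a + 1 ≤ m) →
      ∑ d ∈ Finset.range m, hEval x ((a : ℤ) - (d : ℕ)) * (elemErase x k).coeff d =
      ∑ d ∈ Finset.range (n + a + 1), hEval x ((a : ℤ) - (d : ℕ)) * (elemErase x k).coeff d := by
    intro m hm hmn
    refine Finset.sum_subset (Finset.range_subset_range.2 hm) fun d _ hd => ?_
    rw [Finset.mem_range, not_lt] at hd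
    rcases hmn with hmn | hmn
    · rw [Polynomial.coeff_eq_zero_of_natDegree_lt
        ((natDegree_elemErase_lt x k).trans_le (hmn.trans hd)), mul_zero]
    · rw [hEval, if_neg (by omega), zero_mul]
  rw [h1 n (by omega) (Or.inl le_rfl), ← h1 (a + 1) (by omega) (Or.inr le_rfl)]
  refine Finset.sum_congr rfl fun d hd => ?_
  rw [Finset.mem_range] at hd
  simp only [Polynomial.coeff_coe, PowerSeries.coeff_mk, Nat.cast_sub (Nat.lt_succ_iff.1 hd)]
  rw [mul_comm]

theorem jacobiTrudi_mul {R : Type*} [CommRing R] {n : ℕ} (x : Fin n → R) (f : Fin n → ℕ) :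
    (Matrix.of fun i j : Fin n => hEval x ((f i : ℤ) + (j : ℕ) - (i : ℕ))).det *
      (Matrix.of fun j k : Fin n => (elemErase x k).coeff j.rev).det =
    (Matrix.of fun i j : Fin n => x i ^ (f j + j.rev)).det := by
  rw [← Matrix.det_mul, ← Matrix.det_transpose]
  congr 1
  ext k i
  simp only [Matrix.transpose_apply, Matrix.mul_apply, Matrix.of_apply]
  rw [← sum_hEval_mul_coeff_elemErase x k (f i + i.rev)]
  refine Finset.sum_congr rfl fun j _ => ?_
  congr 2
  have := i.2
  have := j.2
  simp only [Fin.val_rev]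
  omega

theorem det_coeff_elemErase {R : Type*} [CommRing R] {n : ℕ} (x : Fin n → R) :
    (Matrix.of fun j k : Fin n => (elemErase x k).coeff j.rev).det = diffProd x := by
  have h := jacobiTrudi_mul x fun _ => 0
  rw [Matrix.det_of_isUpperTriangular] at h
  · rw [← det_pow_rev]
    simpa [hEval_zero] using h
  · intro i j hij
    have : (j : ℕ) < (i : ℕ) := hij
    simp only [Matrix.of_apply, hEval]
    rw [if_neg (by push_cast; omega)]

theorem det_hEval_mul_diffProd {R : Type*} [CommRing R] {n : ℕ} (x : Fin n → R)
    (f : Fin n → ℕ) :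
    (Matrix.of fun i j : Fin n => hEval x ((f i : ℤ) + (j : ℕ) - (i : ℕ))).det * diffProd x =
    (Matrix.of fun i j : Fin n => x i ^ (f j + j.rev)).det := by
  rw [← det_coeff_elemErase, jacobiTrudi_mul]

theorem map_alternantSum {R S : Type*} [CommRing R] [CommRing S] (φ : R →+* S) {n : ℕ} (q : ℕ)
    (x : Fin n → R) : φ (alternantSum q x) = alternantSum q fun i => φ (x i) := by
  simp only [alternantSum, map_sum, RingHom.map_det]
  refine Finset.sum_congr rfl fun f _ => congrArg Matrix.det ?_
  ext i j
  simp

theorem map_typeBDenom {R S : Type*} [CommRing R] [CommRing S] (φ : R →+* S) {n : ℕ}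
    (x : Fin n → R) : φ (typeBDenom x) = typeBDenom fun i => φ (x i) := by
  simp [typeBDenom, map_prod]

theorem map_det_typeBMatrix {R S : Type*} [CommRing R] [CommRing S] (φ : R →+* S) {n : ℕ} (q : ℕ)
    (x : Fin n → R) : φ (typeBMatrix q x).det = (typeBMatrix q fun i => φ (x i)).det := by
  rw [RingHom.map_det]
  congr 1
  ext i j
  simp [typeBMatrix]

/-- The monomial `e^{a e_i / 2}`. -/
noncomputable def coordMon {n : ℕ} (i : Fin n) (a : ℤ) : WtAlg n :=
  AddMonoidAlgebra.single (Pi.single i a) 1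

theorem coordMon_mul {n : ℕ} (i : Fin n) (a b : ℤ) :
    coordMon i a * coordMon i b = coordMon i (a + b) := by
  rw [coordMon, coordMon, coordMon, AddMonoidAlgebra.single_mul_single, one_mul, Pi.single_add]

theorem xMon_eq_coordMon {n : ℕ} (i : Fin n) : xMon i = coordMon i (-2) := by
  rw [xMon, coordMon]
  congr 1
  ext j
  simp [Pi.single_apply]

theorem xMon_pow {n : ℕ} (i : Fin n) (k : ℕ) : xMon i ^ k = coordMon i (-2 * k) := by
  rw [xMon_eq_coordMon, coordMon, coordMon, AddMonoidAlgebra.single_pow, one_pow, ← Pi.single_smul]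
  simp [mul_comm]

theorem prod_coordMon {n : ℕ} (σ : Equiv.Perm (Fin n)) (c : Fin n → ℤ) :
    ∏ i, coordMon (σ i) (c i) = AddMonoidAlgebra.single (fun k => c (σ⁻¹ k)) 1 := by
  simp only [coordMon, AddMonoidAlgebra.prod_single, Finset.prod_const_one]
  congr 1
  ext k
  rw [Finset.sum_apply, ← Equiv.sum_comp σ⁻¹]
  simp [Pi.single_apply]

theorem weylAlt_eq_det (n : ℕ) (ν : Fin n → ℤ) :
    weylAlt n ν = (Matrix.of fun i j => coordMon i (ν j) - coordMon i (-ν j)).det := by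
  rw [weylAlt, Matrix.det_apply']
  refine Finset.sum_congr rfl fun σ _ => ?_
  have h : ∏ i, (coordMon (σ i) (ν i) - coordMon (σ i) (-ν i)) =
      ∏ i, (-coordMon (σ i) (-ν i) + coordMon (σ i) (ν i)) :=
    Finset.prod_congr rfl fun i _ => by ring
  simp only [Matrix.of_apply]
  rw [h, Finset.prod_add, Finset.powerset_univ, Finset.mul_sum]
  refine Finset.sum_congr rfl fun I _ => ?_
  have h2 : (∏ i ∈ I, -coordMon (σ i) (-ν i)) * ∏ i ∈ Finset.univ \ I, coordMon (σ i) (ν i) =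
      (-1) ^ I.card * ∏ i, coordMon (σ i) ((if i ∈ I then -1 else 1) * ν i) := by
    rw [Finset.prod_neg, mul_assoc, ← Finset.prod_sdiff (Finset.subset_univ I),
      mul_comm (∏ i ∈ I, _)]
    congr 2
    · refine Finset.prod_congr rfl fun i hi => ?_
      simp [(Finset.mem_sdiff.1 hi).2]
    · refine Finset.prod_congr rfl fun i hi => ?_
      simp [hi]
  rw [h2, prod_coordMon, ← mul_assoc]
  have h3 : ((Equiv.Perm.sign σ : ℤˣ) : ℤ) * (-1 : WtAlg n) ^ I.card =
      algebraMap ℤ (WtAlg n) (((Equiv.Perm.sign σ : ℤˣ) : ℤ) * (-1) ^ I.card) := by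
    simp
  rw [h3, ← Algebra.smul_def, AddMonoidAlgebra.smul_single, smul_eq_mul, mul_one]
  rfl

theorem weylAlt_rho2_add (n p : ℕ) :
    weylAlt n (fun i => rho2 n i + p) =
      (∏ i : Fin n, coordMon i (2 * n - 1 + p)) *
        ((Equiv.Perm.sign (Fin.revPerm : Equiv.Perm (Fin n)) : ℤˣ) : ℤ) *
          (typeBMatrix (p + 1) (xMon : Fin n → WtAlg n)).det := by
  rw [weylAlt_eq_det, mul_assoc, ← Matrix.det_permute', ← Matrix.det_mul_column]
  congr 1
  ext1 i j
  have hj := j.2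
  simp only [Matrix.of_apply, Matrix.submatrix_apply, typeBMatrix, id, Fin.revPerm_apply,
    Fin.rev_rev, xMon_pow, mul_sub, coordMon_mul, rho2]
  congr 2
  · ring
  · rw [show p + 1 + 2 * n - 2 - (j : ℕ) = p + (2 * n - 1 - j) by omega]
    push_cast [show (j : ℕ) ≤ 2 * n - 1 by omega, show 1 ≤ 2 * n by omega]
    ring

theorem eval₂_schur (n : ℕ) (f : Fin n → ℕ) :
    MvPolynomial.eval₂ (Int.castRingHom (WtAlg n)) xMon (schur n (extN f)) =
      (Matrix.of fun i j : Fin n =>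
        hEval (xMon : Fin n → WtAlg n) ((f i : ℤ) + (j : ℕ) - (i : ℕ))).det := by
  rw [schur, if_pos (by simp [extN]), ← MvPolynomial.coe_eval₂Hom, RingHom.map_det]
  congr 1
  ext1 i j
  simp only [RingHom.mapMatrix_apply, Matrix.map_apply, Matrix.of_apply, hInt, hpoly, hEval, extN,
    i.2, dite_true, Fin.eta]
  split_ifs <;> simp [map_sum, map_prod]

theorem xMon_injective (n : ℕ) : Function.Injective (xMon : Fin n → WtAlg n) := by
  intro i j h
  by_contra hij
  have hne : (fun k => if k = j then (-2 : ℤ) else 0) ≠ fun k => if k = i then (-2 : ℤ) else 0 :=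
    fun h => by simpa [hij] using congrFun h i
  have := congrArg (fun a : WtAlg n => a.coeff fun k => if k = i then (-2 : ℤ) else 0) h
  simp [xMon, hne] at this

theorem xMon_ne_neg_one {n : ℕ} (i : Fin n) : (xMon i : WtAlg n) ≠ -1 := by
  intro h
  have := congrArg (fun a : WtAlg n => a.coeff 0) h
  have hne : (fun j => if j = i then (-2 : ℤ) else 0) ≠ 0 := fun h => by
    simpa using congrFun h i
  simp [xMon, AddMonoidAlgebra.one_def, hne] at this

theorem isGeneric_xMon (n : ℕ) :
    IsGeneric fun i : Fin n => algebraMap (WtAlg n) (FractionRing (WtAlg n)) (xMon i) where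
  ne_zero i h := by
    rw [← map_zero (algebraMap (WtAlg n) (FractionRing (WtAlg n)))] at h
    simpa [xMon] using IsFractionRing.injective _ _ h
  ne_neg_one i h := by
    rw [← map_one (algebraMap (WtAlg n) (FractionRing (WtAlg n))), ← map_neg] at h
    exact xMon_ne_neg_one i (IsFractionRing.injective _ _ h)
  injective := (IsFractionRing.injective _ _).comp (xMon_injective n)

theorem det_typeBMatrix_xMon (n q : ℕ) :
    (typeBMatrix q (xMon : Fin n → WtAlg n)).det =
      alternantSum q (xMon : Fin n → WtAlg n) * typeBDenom (xMon : Fin n → WtAlg n) := by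
  apply IsFractionRing.injective (WtAlg n) (FractionRing (WtAlg n))
  rw [map_mul, map_det_typeBMatrix, map_alternantSum, map_typeBDenom,
    det_typeBMatrix _ _ (isGeneric_xMon n).ne_zero,
    alternantSum_mul_typeBDenom _ _ (isGeneric_xMon n)]

theorem macdonald_character_identity (n p : ℕ) :
    weylAlt n (fun i => rho2 n i + p) =
      AddMonoidAlgebra.single (fun _ : Fin n => (p : ℤ)) 1 *
        (∑ f : {f : Fin n → Fin (p + 1) // Antitone f},
          MvPolynomial.eval₂ (Int.castRingHom (WtAlg n)) xMon
            (schur n (extN fun i => ((f : Fin n → Fin (p + 1)) i : ℕ)))) *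
        weylAlt n (rho2 n) := by
  have h0 := weylAlt_rho2_add n 0
  simp only [Nat.cast_zero, add_zero, zero_add] at h0
  have hshift : ∏ i : Fin n, coordMon i (2 * (n : ℤ) - 1 + p) =
      AddMonoidAlgebra.single (fun _ : Fin n => (p : ℤ)) 1 *
        ∏ i : Fin n, coordMon i (2 * (n : ℤ) - 1) := by
    have h := prod_coordMon (1 : Equiv.Perm (Fin n)) fun _ => (p : ℤ)
    rw [← h, ← Finset.prod_mul_distrib]
    refine Finset.prod_congr rfl fun i _ => ?_
    rw [Equiv.Perm.one_apply, coordMon_mul, add_comm]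
  have hsum : alternantSum (p + 1) (xMon : Fin n → WtAlg n) =
      (∑ f : {f : Fin n → Fin (p + 1) // Antitone f},
        MvPolynomial.eval₂ (Int.castRingHom (WtAlg n)) xMon
          (schur n (extN fun i => ((f : Fin n → Fin (p + 1)) i : ℕ)))) *
        diffProd (xMon : Fin n → WtAlg n) := by
    rw [alternantSum, Finset.sum_mul]
    refine Finset.sum_congr rfl fun f _ => ?_
    rw [eval₂_schur, det_hEval_mul_diffProd]
  rw [weylAlt_rho2_add, show weylAlt n (rho2 n) = _ from h0, det_typeBMatrix_xMon,
    det_typeBMatrix_xMon, alternantSum_one, hshift, hsum]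
  ring
end

section
/- Parabosonic character identity: Σ_{μ = μ'} (−1)^{(|μ|+r(μ))/2} s_{[μ^{(p)}]'}(x_1,...,x_n) = (Σ_{λ : l(λ) ≤ p} s_λ(x_1,...,x_n)) · Π_i (1 − x_i) · Π_{i<j} (1 − x_i x_j), as an identity of symmetric formal power series, where the left sum is over self-conjugate partitions μ and [μ^{(p)}]' is the conjugate of the p-augmented partition, and the right sum is over partitions with at most p rows. -/
/-!
STATEMENT 14: Parabosonic character identity:
Σ_{μ = μ'} (−1)^{(|μ|+r(μ))/2} s_{[μ^{(p)}]'}(x_1,...,x_n)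
  = (Σ_{λ : l(λ) ≤ p} s_λ(x_1,...,x_n)) · Π_i (1 − x_i) · Π_{i<j} (1 − x_i x_j)
as symmetric formal power series.  Here [μ^{(p)}]' = (α | α+p) for μ = (α | α),
and s_λ = 0 when λ has more than n parts (Jacobi–Trudi convention); hence on
the left only self-conjugate μ in the n×n square can contribute, so the left
side is the polynomial given by that finite sum.  The right side is an infinite
sum of polynomials; the equality of formal power series is stated
coefficientwise: for each exponent d only partitions λ with l(λ) ≤ p and
|λ| ≤ |d| (all of whose parts are ≤ |d|) can contribute to the coefficient at d.
-/

open MvPolynomial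
open scoped Classical

noncomputable def conjP (μ : ℕ → ℕ) : ℕ → ℕ := fun j => Nat.card {i : ℕ | j < μ i}
noncomputable def psize (μ : ℕ → ℕ) : ℕ := ∑ᶠ i, μ i
noncomputable def prank (μ : ℕ → ℕ) : ℕ := Nat.card {i : ℕ | i < μ i}

def frob (r : ℕ) (α β : ℕ → ℕ) : ℕ → ℕ := fun i =>
  if i < r then α i + i + 1
  else ((Finset.range r).filter fun k => i ≤ β k + k).card

/-- The conjugate [μ^{(p)}]' = (α | α + p) of the p-augmentation of a
self-conjugate partition μ = (α | α). -/
noncomputable def conjAugP (p : ℕ) (μ : ℕ → ℕ) : ℕ → ℕ :=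
  frob (prank μ) (fun k => μ k - (k + 1)) (fun k => (μ k - (k + 1)) + p)

def IsSCBox (n : ℕ) (f : Fin n → Fin (n + 1)) : Prop :=
  Antitone f ∧ conjP (extN fun i => (f i : ℕ)) = extN fun i => (f i : ℕ)

section Alternant

variable {R : Type*} [CommRing R]

/-- The generalized Vandermonde determinant `det (x i ^ e j)`. -/
def alternant {n : ℕ} (x : Fin n → R) (e : Fin n → ℕ) : R :=
  Matrix.det (Matrix.of fun i j => x i ^ e j)

theorem alternant_mem_pow {n : ℕ} {M : Ideal R} {x : Fin n → R} (hx : ∀ i, x i ∈ M)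
    (e : Fin n → ℕ) : alternant x e ∈ M ^ ∑ j, e j := by
  unfold alternant
  rw [← Matrix.det_transpose, Matrix.det_apply]
  refine Ideal.sum_mem _ fun σ _ => ?_
  rw [Units.smul_def]
  refine zsmul_mem ?_ _
  rw [← Equiv.sum_comp σ, ← Finset.prod_pow_eq_pow_sum]
  exact Ideal.prod_mem_prod fun i _ => Ideal.pow_mem_pow (hx _) _

theorem alternant_comp_perm {n : ℕ} (x : Fin n → R) (e : Fin n → ℕ) (σ : Equiv.Perm (Fin n)) :
    alternant x (e ∘ σ) = ((Equiv.Perm.sign σ : ℤˣ) : ℤ) * alternant x e :=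
  Matrix.det_permute' σ (Matrix.of fun i j => x i ^ e j)

theorem alternant_add_const {n : ℕ} (x : Fin n → R) (e : Fin n → ℕ) (k : ℕ) :
    alternant x (fun j => e j + k) = (∏ i, x i) ^ k * alternant x e := by
  unfold alternant
  rw [← Finset.prod_pow, ← Matrix.det_mul_column]
  congr 1
  ext i j
  simp [pow_add, mul_comm]

/-- Laplace expansion along the last column. -/
theorem det_eq_sum_last_column {n : ℕ} (A : Matrix (Fin (n + 1)) (Fin (n + 1)) R) :
    A.det = ∑ i : Fin (n + 1), (-1) ^ ((i : ℕ) + n) * A i (Fin.last n) *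
      (A.submatrix i.succAbove Fin.castSucc).det := by
  rw [Matrix.det_succ_column A (Fin.last n)]
  simp

theorem alternant_succ {n : ℕ} (x : Fin (n + 1) → R) (e : Fin (n + 1) → ℕ)
    (he : ∀ j : Fin n, 1 ≤ e j.castSucc) (h0 : e (Fin.last n) = 0) :
    alternant x e = ∑ i : Fin (n + 1), (-1) ^ ((i : ℕ) + n) * (∏ j, x (i.succAbove j)) *
      alternant (x ∘ i.succAbove) (fun j => e j.castSucc - 1) := by
  rw [alternant, det_eq_sum_last_column]
  refine Finset.sum_congr rfl fun i _ => ?_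
  have h := alternant_add_const (x ∘ i.succAbove) (fun j => e j.castSucc - 1) 1
  simp only [pow_one, Function.comp_apply] at h
  rw [mul_assoc _ (∏ j, _), ← h]
  simp only [Matrix.of_apply, h0, pow_zero, mul_one, alternant]
  congr 2
  ext a b
  simp [Nat.sub_add_cancel (he b)]

end Alternant

section Denominator

variable {R : Type*} [CommRing R]

/-- The entry of the determinant `augDenominator` at the value `x` and the column `j`. -/
def augEntry (n p : ℕ) (x : R) (j : ℕ) : R :=
  if j < p then x ^ (n - 1 - j) else x ^ (n - 1 - j) - (-1) ^ p * x ^ (n + j - p)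

/-- The determinantal form of the numerator; for `p = 0` it is the Weyl denominator of type `B`. -/
def augDenominator {n : ℕ} (p : ℕ) (x : Fin n → R) : R :=
  Matrix.det (Matrix.of fun i j : Fin n => augEntry n p (x i) j)

/-- The columns of `augDenominator` except for the last one span this submodule. -/
def augSpan {n : ℕ} (p : ℕ) (x : Fin (n + 1) → R) : Submodule R (Fin (n + 1) → R) :=
  Submodule.span R (Set.range fun (j : Fin n) i => augEntry (n + 1) p (x i) j)

theorem augEntry_mem_augSpan {n p : ℕ} (x : Fin (n + 1) → R) {j : ℕ} (hj : j < n) :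
    (fun i => augEntry (n + 1) p (x i) j) ∈ augSpan p x :=
  Submodule.subset_span ⟨⟨j, hj⟩, rfl⟩

theorem pow_mem_augSpan {n p : ℕ} (hp : p ≤ n) (x : Fin (n + 1) → R) {k : ℕ}
    (h1 : n + 1 - p ≤ k) (h2 : k ≤ n) : (fun i => x i ^ k) ∈ augSpan p x := by
  have h := augEntry_mem_augSpan (p := p) x (j := n - k) (by omega)
  have e : n + 1 - 1 - (n - k) = k := by omega
  simpa only [augEntry, if_pos (show n - k < p by omega), e] using h

theorem pow_sub_pow_mem_augSpan {n p : ℕ} (hp : p ≤ n) (x : Fin (n + 1) → R) {k : ℕ}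
    (h1 : 1 ≤ k) (h2 : k ≤ n) :
    (fun i => x i ^ k - (-1) ^ p * x i ^ (n + 1 - p + (n - k))) ∈ augSpan p x := by
  by_cases h : n + 1 - p ≤ k
  · have ha := pow_mem_augSpan hp x h h2
    have hb := pow_mem_augSpan hp x (k := n + 1 - p + (n - k)) (by omega) (by omega)
    exact sub_mem ha (Submodule.smul_mem _ ((-1) ^ p) hb)
  · have h := augEntry_mem_augSpan (p := p) x (j := n - k) (by omega)
    have e : n + 1 - 1 - (n - k) = k := by omega
    have e' : n + 1 + (n - k) - p = n + 1 - p + (n - k) := by omega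
    simpa only [augEntry, if_neg (show ¬ n - k < p by omega), e, e'] using h

theorem exists_augSpan_one_add_mul {n p : ℕ} (hp : p ≤ n) (x : Fin (n + 1) → R) (k : ℕ)
    (h1 : 1 ≤ k) (h2 : k ≤ n + 1) : ∃ u ∈ augSpan p x, ∀ i,
      x i ^ k - (-1) ^ p * x i ^ (n + 1 - p + (n + 1 - k)) = (1 + x i) * u i := by
  induction h2 using Nat.decreasingInduction with
  | self =>
    refine ⟨∑ s ∈ Finset.range p, ((-1) ^ (p - 1 - s) : R) • fun i => x i ^ (n + 1 - p + s),
      Submodule.sum_mem _ fun s hs => Submodule.smul_mem _ _ ?_, fun i => ?_⟩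
    · rw [Finset.mem_range] at hs
      exact pow_mem_augSpan hp x (by omega) (by omega)
    · have h := (Commute.all (x i) (-1)).geom_sum₂_mul p
      have e : x i ^ (n + 1) = x i ^ (n + 1 - p) * x i ^ p := by
        rw [← pow_add]; congr 1; omega
      have : (∑ s ∈ Finset.range p, ((-1) ^ (p - 1 - s) : R) • fun i => x i ^ (n + 1 - p + s)) i =
          x i ^ (n + 1 - p) * ∑ s ∈ Finset.range p, x i ^ s * (-1) ^ (p - 1 - s) := by
        rw [Finset.sum_apply, Finset.mul_sum]
        refine Finset.sum_congr rfl fun s _ => ?_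
        simp only [Pi.smul_apply, smul_eq_mul, pow_add]
        ring
      rw [this, e, Nat.sub_self, add_zero]
      linear_combination (-x i ^ (n + 1 - p)) * h
  | of_succ k hk ih =>
    obtain ⟨u, hu, hux⟩ := ih (by omega)
    refine ⟨_, sub_mem (pow_sub_pow_mem_augSpan hp x h1 (by omega)) hu, fun i => ?_⟩
    have e1 : n + 1 - p + (n + 1 - (k + 1)) = n + 1 - p + (n - k) := by omega
    have e2 : n + 1 - p + (n + 1 - k) = n + 1 - p + (n - k) + 1 := by omega
    have := hux i
    rw [e1] at this
    simp only [Pi.sub_apply, e2]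
    linear_combination -this

theorem exists_augSpan_one_add_mul_zero {n p : ℕ} (hp : p ≤ n) (x : Fin (n + 1) → R) :
    ∃ u ∈ augSpan p x, ∀ i, 1 - (-1) ^ p * x i ^ (n + 1 - p + (n + 1)) =
      (1 + x i) * (augEntry (n + 1) p (x i) n + u i) := by
  obtain ⟨u, hu, hux⟩ := exists_augSpan_one_add_mul hp x 1 le_rfl (by omega)
  refine ⟨-u, neg_mem hu, fun i => ?_⟩
  have := hux i
  have e1 : n + 1 - p + (n + 1 - 1) = n + 1 - p + n := by omega
  have e2 : n + 1 + n - p = n + 1 - p + n := by omega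
  rw [e1] at this
  simp only [augEntry, if_neg (show ¬ n < p by omega), e2, Pi.neg_apply]
  rw [show n + 1 - 1 - n = 0 by omega]
  linear_combination -this

theorem prod_sub_mul_eq_sum {n : ℕ} (x : Fin n → R) (a b : R) :
    ∏ j, (b - a * x j) =
      ∑ t : Finset (Fin n), (∏ j ∈ t, -x j) * (a ^ t.card * b ^ (n - t.card)) := by
  have : ∀ j, b - a * x j = a * -x j + b := fun j => by ring
  simp only [this]
  rw [Finset.prod_add, Finset.powerset_univ]
  refine Finset.sum_congr rfl fun t _ => ?_
  rw [Finset.prod_mul_distrib, Finset.prod_const, Finset.prod_const, ← Finset.compl_eq_univ_sdiff,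
    Finset.card_compl, Fintype.card_fin]
  ring

theorem prod_succAbove_sub_augEntry_mem [IsDomain R] {n p : ℕ} (hp : p ≤ n) (x : Fin (n + 1) → R)
    (hx : ∀ i, 1 + x i ≠ 0) :
    (fun i : Fin (n + 1) => (1 - x i) * ∏ j, (1 - x i * x (i.succAbove j)) -
      augEntry (n + 1) p (x i) n) ∈ augSpan p x := by
  obtain ⟨u₀, hu₀, hux₀⟩ := exists_augSpan_one_add_mul_zero hp x
  have key : ∀ t : Finset (Fin (n + 1)), ∃ u ∈ augSpan p x, t ≠ ∅ → ∀ i,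
      x i ^ t.card - (-1) ^ p * x i ^ (n + 1 - p + (n + 1 - t.card)) = (1 + x i) * u i := by
    intro t
    by_cases ht : t = ∅
    · exact ⟨0, zero_mem _, fun h => absurd ht h⟩
    · obtain ⟨u, hu, h⟩ := exists_augSpan_one_add_mul hp x t.card
        (Finset.card_pos.2 (Finset.nonempty_iff_ne_empty.2 ht)) (by simpa using t.card_le_univ)
      exact ⟨u, hu, fun _ => h⟩
  choose u hu hux using key
  have hmem : u₀ + ∑ t ∈ Finset.univ.erase (∅ : Finset (Fin (n + 1))), (∏ j ∈ t, -x j) • u t ∈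
      augSpan p x :=
    add_mem hu₀ (Submodule.sum_mem _ fun t _ => Submodule.smul_mem _ _ (hu t))
  convert hmem using 1
  funext i
  refine mul_left_cancel₀ (hx i) ?_
  have h1 := prod_sub_mul_eq_sum x (x i) 1
  have h2 := prod_sub_mul_eq_sum x 1 (x i)
  rw [Finset.prod_eq_zero (Finset.mem_univ i) (by ring)] at h2
  have h3 : ∏ j, (1 - x i * x j) =
      (1 + x i) * ((1 - x i) * ∏ j, (1 - x i * x (i.succAbove j))) := by
    rw [Fin.prod_univ_succAbove _ i]; ring
  have h4 : ∏ j, (1 - x i * x j) = ∑ t : Finset (Fin (n + 1)), (∏ j ∈ t, -x j) *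
      (x i ^ t.card - (-1) ^ p * x i ^ (n + 1 - p + (n + 1 - t.card))) := by
    have : ∀ t : Finset (Fin (n + 1)), (∏ j ∈ t, -x j) *
        (x i ^ t.card - (-1) ^ p * x i ^ (n + 1 - p + (n + 1 - t.card))) =
        (∏ j ∈ t, -x j) * (x i ^ t.card * 1 ^ (n + 1 - t.card)) - (-1) ^ p * x i ^ (n + 1 - p) *
        ((∏ j ∈ t, -x j) * (1 ^ t.card * x i ^ (n + 1 - t.card))) := fun t => by
      simp only [one_pow, pow_add]; ring
    simp only [this]
    rw [Finset.sum_sub_distrib, ← Finset.mul_sum, ← h1, ← h2, mul_zero, sub_zero]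
  rw [← Finset.add_sum_erase _ _ (Finset.mem_univ ∅)] at h4
  simp only [Finset.prod_empty, Finset.card_empty, pow_zero, one_mul, Nat.sub_zero] at h4
  rw [mul_sub, ← h3, h4, hux₀, Pi.add_apply, Finset.sum_apply, mul_add, mul_add, Finset.mul_sum]
  have : ∀ t ∈ Finset.univ.erase (∅ : Finset (Fin (n + 1))), (∏ j ∈ t, -x j) *
      (x i ^ t.card - (-1) ^ p * x i ^ (n + 1 - p + (n + 1 - t.card))) =
      (1 + x i) * ((∏ j ∈ t, -x j) • u t) i := fun t ht => by
    rw [hux t (Finset.ne_of_mem_erase ht) i, Pi.smul_apply, smul_eq_mul]; ring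
  rw [Finset.sum_congr rfl this]
  ring

theorem det_updateCol_last_of_mem_augSpan {n p : ℕ} (x u : Fin (n + 1) → R)
    (hu : u ∈ augSpan p x) :
    ((Matrix.of fun i j : Fin (n + 1) => augEntry (n + 1) p (x i) j).updateCol
      (Fin.last n) u).det = 0 := by
  induction hu using Submodule.span_induction with
  | mem u h =>
    obtain ⟨j, rfl⟩ := h
    refine Matrix.det_zero_of_column_eq (Fin.castSucc_lt_last j).ne fun i => ?_
    rw [Matrix.updateCol_self, Matrix.updateCol_ne (Fin.castSucc_lt_last j).ne]
    simp
  | zero => exact Matrix.det_eq_zero_of_column_eq_zero (Fin.last n) fun i => by simp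
  | add u v _ _ hu hv => rw [Matrix.det_updateCol_add, hu, hv, add_zero]
  | smul a u _ hu => rw [Matrix.det_updateCol_smul, hu, mul_zero]

theorem mul_augEntry {n p : ℕ} {j : ℕ} (hj : j < n) (x : R) :
    x * augEntry n p x j = augEntry (n + 1) p x j := by
  have e1 : n + 1 - 1 - j = n - 1 - j + 1 := by omega
  unfold augEntry
  split_ifs with h
  · rw [e1]; ring
  · have e2 : n + 1 + j - p = n + j - p + 1 := by omega
    rw [e1, e2]; ring

/-- The recursion of the numerator in the number of variables. -/
theorem augDenominator_succ [IsDomain R] {n p : ℕ} (hp : p ≤ n) (x : Fin (n + 1) → R)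
    (hx : ∀ i, 1 + x i ≠ 0) :
    augDenominator p x = ∑ i : Fin (n + 1), (-1) ^ ((i : ℕ) + n) * (∏ j, x (i.succAbove j)) *
      (((1 - x i) * ∏ j, (1 - x i * x (i.succAbove j))) *
        augDenominator p (x ∘ i.succAbove)) := by
  set A := Matrix.of fun i j : Fin (n + 1) => augEntry (n + 1) p (x i) j with hA
  set v : Fin (n + 1) → R := fun i => (1 - x i) * ∏ j, (1 - x i * x (i.succAbove j))
  have h1 : (A.updateCol (Fin.last n) v).det = augDenominator p x := by
    have hv : v = (fun i => A i (Fin.last n)) + fun i => v i - augEntry (n + 1) p (x i) n := by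
      funext i
      simp [hA]
    rw [hv, Matrix.det_updateCol_add, det_updateCol_last_of_mem_augSpan _ _
      (prod_succAbove_sub_augEntry_mem hp x hx), add_zero]
    congr 1
    exact Matrix.updateCol_eq_self _ _
  rw [← h1, det_eq_sum_last_column]
  refine Finset.sum_congr rfl fun i _ => ?_
  have h2 : ((A.updateCol (Fin.last n) v).submatrix i.succAbove Fin.castSucc).det =
      (∏ j, x (i.succAbove j)) * augDenominator p (x ∘ i.succAbove) := by
    rw [augDenominator, ← Matrix.det_mul_column]
    congr 1
    ext a b
    rw [Matrix.submatrix_apply, Matrix.updateCol_ne (Fin.castSucc_lt_last b).ne]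
    simp [hA, mul_augEntry b.2]
  rw [h2, Matrix.updateCol_self]
  ring

end Denominator
section BoundedSum

variable {R : Type*} [CommRing R]

theorem extN_of_lt {p : ℕ} (g : Fin p → ℕ) {i : ℕ} (h : i < p) : extN g i = g ⟨i, h⟩ :=
  dif_pos h

theorem extN_of_le {p : ℕ} (g : Fin p → ℕ) {i : ℕ} (h : p ≤ i) : extN g i = 0 :=
  dif_neg h.not_gt

theorem extN_coe {p : ℕ} (g : Fin p → ℕ) (i : Fin p) : extN g i = g i :=
  extN_of_lt g i.2

theorem extN_snoc_zero {N p : ℕ} (g : Fin p → Fin (N + 1)) :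
    (extN fun i => ((Fin.snoc g 0 : Fin (p + 1) → Fin (N + 1)) i : ℕ)) =
      extN fun i => (g i : ℕ) := by
  funext i
  rcases lt_trichotomy i p with h | rfl | h
  · rw [extN_of_lt _ (h.trans p.lt_succ_self), extN_of_lt _ h]
    exact congrArg Fin.val (Fin.snoc_castSucc (α := fun _ => Fin (N + 1)) 0 g ⟨i, h⟩)
  · rw [extN_of_lt _ i.lt_succ_self, extN_of_le _ le_rfl]
    exact congrArg Fin.val (Fin.snoc_last (α := fun _ => Fin (N + 1)) 0 g)
  · rw [extN_of_le _ h, extN_of_le _ h.le]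

theorem antitone_snoc_zero {N p : ℕ} {g : Fin p → Fin (N + 1)} (hg : Antitone g) :
    Antitone (Fin.snoc g 0 : Fin (p + 1) → Fin (N + 1)) := by
  intro a b hab
  induction b using Fin.lastCases with
  | last => simp
  | cast b =>
    induction a using Fin.lastCases with
    | last => exact absurd hab (Fin.castSucc_lt_last b).not_ge
    | cast a => simpa using hg (Fin.castSucc_le_castSucc_iff.1 hab)

/-- Partitions with at most `p + 1` parts either have at most `p` parts or a nonzero last part. -/
theorem sum_antitone_succ (N p : ℕ) (G : (ℕ → ℕ) → R) :
    ∑ g : {g : Fin (p + 1) → Fin (N + 1) // Antitone g}, G (extN fun i => (g.1 i : ℕ)) =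
      ∑ g : {g : Fin p → Fin (N + 1) // Antitone g}, G (extN fun i => (g.1 i : ℕ)) +
      ∑ g : {g : Fin (p + 1) → Fin (N + 1) // Antitone g},
        if g.1 (Fin.last p) = 0 then 0 else G (extN fun i => (g.1 i : ℕ)) := by
  have h : ∑ g : {g : Fin p → Fin (N + 1) // Antitone g}, G (extN fun i => (g.1 i : ℕ)) =
      ∑ g : {g : Fin (p + 1) → Fin (N + 1) // Antitone g},
        if g.1 (Fin.last p) = 0 then G (extN fun i => (g.1 i : ℕ)) else 0 := by
    refine Fintype.sum_of_injective (fun g => ⟨Fin.snoc g.1 0, antitone_snoc_zero g.2⟩)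
      (fun g g' hgg => ?_) _ _ (fun g hg => ?_) fun g => ?_
    · exact Subtype.ext (Fin.snoc_injective2 (α := fun _ => Fin (N + 1))
        (congrArg Subtype.val hgg)).1
    · refine if_neg fun h0 => hg ⟨⟨fun i => g.1 i.castSucc, fun a b hab => g.2 (by simpa)⟩, ?_⟩
      refine Subtype.ext (funext fun i => ?_)
      induction i using Fin.lastCases with
      | last => simp [h0]
      | cast i => simp
    · simp only [Fin.snoc_last, if_true, extN_snoc_zero]
  rw [h, ← Finset.sum_add_distrib]
  exact Finset.sum_congr rfl fun g _ => by split_ifs <;> simp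

/-- Adding a full column is a bijection onto the partitions with a nonzero last part. -/
theorem sum_antitone_add_one (N p : ℕ) (G : (Fin (p + 1) → ℕ) → R) :
    (∑ g : {g : Fin (p + 1) → Fin (N + 1) // Antitone g},
        if g.1 (Fin.last p) = 0 then 0 else G fun i => (g.1 i : ℕ)) =
      ∑ g : {g : Fin (p + 1) → Fin (N + 1) // Antitone g},
        if g.1 0 = Fin.last N then 0 else G fun i => (g.1 i : ℕ) + 1 := by
  simp only [← ite_not (_ = _), ← Finset.sum_filter]
  symm
  refine Finset.sum_nbij'
    (fun g => ⟨fun k => ⟨min ((g.1 k : ℕ) + 1) N, by omega⟩, fun a b hab => ?_⟩)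
    (fun g => ⟨fun k => ⟨(g.1 k : ℕ) - 1, by omega⟩, fun a b hab => ?_⟩) ?_ ?_ ?_ ?_ ?_
  · have := Fin.le_def.1 (g.2 hab)
    rw [Fin.le_def]
    dsimp only
    omega
  · have := Fin.le_def.1 (g.2 hab)
    rw [Fin.le_def]
    dsimp only
    omega
  · intro g hg
    simp only [Finset.mem_filter, Finset.mem_univ, true_and, Fin.ext_iff, Fin.val_last,
      Fin.val_zero] at hg ⊢
    have := (g.1 0).2
    omega
  · intro g hg
    simp only [Finset.mem_filter, Finset.mem_univ, true_and, Fin.ext_iff, Fin.val_last,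
      Fin.val_zero] at hg ⊢
    have := (g.1 0).2
    have := Fin.le_def.1 (g.2 (Fin.zero_le (Fin.last p)))
    omega
  · intro g hg
    refine Subtype.ext (funext fun k => Fin.ext ?_)
    simp only [Finset.mem_filter, Finset.mem_univ, true_and, Fin.ext_iff, Fin.val_last] at hg ⊢
    have := (g.1 0).2
    have := Fin.le_def.1 (g.2 (Fin.zero_le k))
    omega
  · intro g hg
    refine Subtype.ext (funext fun k => Fin.ext ?_)
    simp only [Finset.mem_filter, Finset.mem_univ, true_and, Fin.ext_iff, Fin.val_zero] at hg ⊢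
    have := (g.1 k).2
    have := Fin.le_def.1 (g.2 (Fin.le_last k))
    omega
  · intro g hg
    congr 1
    funext k
    simp only [Finset.mem_filter, Finset.mem_univ, true_and, Fin.ext_iff, Fin.val_last] at hg ⊢
    have := (g.1 0).2
    have := Fin.le_def.1 (g.2 (Fin.zero_le k))
    omega

/-- The sum of the alternants of the partitions with at most `p` parts, all of them at most `N`. -/
def boundedSum {n : ℕ} (N p : ℕ) (x : Fin n → R) : R :=
  ∑ g : {g : Fin p → Fin (N + 1) // Antitone g},
    if (extN fun i => (g.1 i : ℕ)) n = 0 then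
      alternant x fun j => (extN fun i => (g.1 i : ℕ)) j + (n - 1 - j) else 0

theorem boundedSum_of_le {n p N : ℕ} (hp : p ≤ n) (x : Fin n → R) :
    boundedSum N p x = ∑ g : {g : Fin p → Fin (N + 1) // Antitone g},
      alternant x fun j => (extN fun i => (g.1 i : ℕ)) j + (n - 1 - j) :=
  Finset.sum_congr rfl fun _ _ => if_pos (extN_of_le _ hp)

theorem boundedSum_fin_zero (N : ℕ) (x : Fin 0 → R) : boundedSum N 0 x = 1 := by
  rw [boundedSum_of_le le_rfl]
  simp only [alternant, Matrix.det_fin_zero, Finset.sum_const, Finset.card_univ]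
  rw [Fintype.card_eq_one_iff.2 ⟨⟨Fin.elim0, fun a => a.elim0⟩,
    fun g => Subtype.ext (funext fun a => a.elim0)⟩, one_smul]

theorem boundedSum_add_one_of_le {n p N : ℕ} (hp : n ≤ p) (x : Fin n → R) :
    boundedSum N (p + 1) x = boundedSum N p x := by
  unfold boundedSum
  rw [sum_antitone_succ N p fun lam => if lam n = 0 then
      alternant x fun j => lam j + (n - 1 - j) else 0]
  refine add_eq_left.2 (Finset.sum_eq_zero fun g _ => ?_)
  split_ifs with h1 h2
  · rfl
  · rw [extN_of_lt _ (Nat.lt_succ_of_le hp)] at h2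
    have := Fin.le_def.1 (g.2 (Fin.le_last ⟨n, Nat.lt_succ_of_le hp⟩))
    exact absurd (Fin.ext (by simp only [Fin.val_zero]; omega)) h1
  · rfl

theorem boundedSum_succ {n p N : ℕ} (hp : p ≤ n) (x : Fin (n + 1) → R) :
    boundedSum N p x = ∑ i : Fin (n + 1), (-1) ^ ((i : ℕ) + n) * (∏ j, x (i.succAbove j)) *
      boundedSum N p (x ∘ i.succAbove) := by
  simp only [boundedSum_of_le hp, boundedSum_of_le (hp.trans n.le_succ), Finset.mul_sum]
  rw [Finset.sum_comm]
  refine Finset.sum_congr rfl fun g _ => ?_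
  rw [alternant_succ]
  · refine Finset.sum_congr rfl fun i _ => ?_
    congr 2
    funext j
    simp only [Fin.val_castSucc]
    omega
  · intro j
    simp only [Fin.val_castSucc]
    omega
  · simp only [Fin.val_last, extN_of_le _ hp]
    omega

theorem sum_staircase_succ (n : ℕ) :
    ∑ j : Fin (n + 1), (n + 1 - 1 - (j : ℕ)) = n + ∑ j : Fin n, (n - 1 - (j : ℕ)) := by
  rw [Fin.sum_univ_succ]
  congr 1
  refine Finset.sum_congr rfl fun j _ => ?_
  rw [Fin.val_succ]
  omega

theorem boundedSum_top {n N : ℕ} {M : Ideal R} (x : Fin (n + 1) → R) (hx : ∀ i, x i ∈ M) :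
    (1 - ∏ i, x i) * boundedSum N (n + 1) x - boundedSum N n x ∈
      M ^ (N + 1 + ∑ j : Fin (n + 1), (n + 1 - 1 - (j : ℕ))) := by
  have h1 : boundedSum N (n + 1) x = boundedSum N n x +
      ∑ g : {g : Fin (n + 1) → Fin (N + 1) // Antitone g},
        if g.1 (Fin.last n) = 0 then 0 else
          alternant x fun j => (g.1 j : ℕ) + (n + 1 - 1 - j) := by
    rw [boundedSum_of_le le_rfl, boundedSum_of_le n.le_succ,
      sum_antitone_succ N n fun lam => alternant x fun j => lam j + (n + 1 - 1 - j)]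
    simp only [extN_coe]
  rw [sum_antitone_add_one N n fun lam => alternant x fun j => lam j + (n + 1 - 1 - j)] at h1
  have h2 : (1 - ∏ i, x i) * boundedSum N (n + 1) x - boundedSum N n x =
      -∑ g : {g : Fin (n + 1) → Fin (N + 1) // Antitone g}, if g.1 0 = Fin.last N then
        (∏ i, x i) * alternant x fun j => (g.1 j : ℕ) + (n + 1 - 1 - j) else 0 := by
    rw [sub_mul, one_mul]
    nth_rewrite 1 [h1]
    rw [boundedSum_of_le le_rfl]
    simp only [extN_coe]
    rw [sub_right_comm, add_sub_cancel_left, Finset.mul_sum, ← Finset.sum_sub_distrib,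
      ← Finset.sum_neg_distrib]
    refine Finset.sum_congr rfl fun g _ => ?_
    split_ifs
    · ring
    · have := alternant_add_const x (fun j => (g.1 j : ℕ) + (n + 1 - 1 - j)) 1
      rw [pow_one] at this
      rw [← this, neg_zero, sub_eq_zero]
      congr 1
      funext j
      omega
  rw [h2]
  refine neg_mem (Ideal.sum_mem _ fun g _ => ?_)
  split_ifs with h
  · have ha := Ideal.mul_mem_mul (Ideal.prod_mem M (Finset.mem_univ 0) (hx 0))
      (alternant_mem_pow hx fun j => (g.1 j : ℕ) + (n + 1 - 1 - j))
    rw [← pow_succ'] at ha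
    refine Ideal.pow_le_pow_right ?_ ha
    rw [Finset.sum_add_distrib]
    have hb := Finset.single_le_sum (f := fun j => (g.1 j : ℕ)) (fun _ _ => Nat.zero_le _)
      (Finset.mem_univ (0 : Fin (n + 1)))
    simp only [h, Fin.val_last] at hb
    omega
  · exact zero_mem _

end BoundedSum

section Congruence

variable {R : Type*} [CommRing R]

/-- The product `∏ (1 - x i) * ∏ (1 - x i * x j)`. -/
def littlewoodProd {n : ℕ} (x : Fin n → R) : R :=
  (∏ i, (1 - x i)) *
    ∏ q ∈ Finset.univ.filter (fun q : Fin n × Fin n => q.1 < q.2), (1 - x q.1 * x q.2)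

theorem littlewoodProd_succAbove {n : ℕ} (x : Fin (n + 1) → R) (i : Fin (n + 1)) :
    littlewoodProd x = ((1 - x i) * ∏ j, (1 - x i * x (i.succAbove j))) *
      littlewoodProd (x ∘ i.succAbove) := by
  have h : ∏ q ∈ Finset.univ.filter (fun q : Fin (n + 1) × Fin (n + 1) => q.1 < q.2),
      (1 - x q.1 * x q.2) = (∏ j, (1 - x i * x (i.succAbove j))) *
      ∏ q ∈ Finset.univ.filter (fun q : Fin n × Fin n => q.1 < q.2),
        (1 - x (i.succAbove q.1) * x (i.succAbove q.2)) := by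
    simp only [Finset.prod_filter, Fintype.prod_prod_type]
    rw [Fin.prod_univ_succAbove _ i, Fin.prod_univ_succAbove _ i]
    simp only [lt_irrefl, if_false, one_mul]
    conv_lhs => enter [2, 2, a]; rw [Fin.prod_univ_succAbove _ i]
    rw [Finset.prod_mul_distrib, ← mul_assoc, ← Finset.prod_mul_distrib]
    simp only [(Fin.strictMono_succAbove i).lt_iff_lt]
    congr 1
    refine Finset.prod_congr rfl fun j _ => ?_
    rcases lt_or_gt_of_ne (Fin.succAbove_ne i j) with h | h
    · rw [if_neg h.not_gt, if_pos h, one_mul, mul_comm (x _)]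
    · rw [if_pos h, if_neg h.not_gt, mul_one]
  unfold littlewoodProd
  rw [h, Fin.prod_univ_succAbove _ i]
  simp only [Function.comp_apply]
  ring

theorem augDenominator_of_le {n p : ℕ} (hp : n ≤ p) (x : Fin n → R) :
    augDenominator p x = alternant x fun j => n - 1 - j := by
  unfold augDenominator alternant
  congr 1
  ext i j
  simp [augEntry, j.2.trans_le hp]

theorem augDenominator_last (n : ℕ) (x : Fin (n + 1) → R) :
    augDenominator n x = (1 - ∏ i, x i) * augDenominator (n + 1) x := by
  rw [augDenominator_of_le le_rfl]
  set A := Matrix.of fun i j : Fin (n + 1) => x i ^ (n + 1 - 1 - (j : ℕ)) with hA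
  have h1 : augDenominator n x = (A.updateCol (Fin.last n)
      ((fun i => A i (Fin.last n)) + (-(-1) ^ n : R) • fun i => x i ^ (n + 1))).det := by
    unfold augDenominator
    congr 1
    ext i j
    induction j using Fin.lastCases with
    | last =>
      simp [hA, augEntry, sub_eq_add_neg]
    | cast j =>
      rw [Matrix.updateCol_ne (Fin.castSucc_lt_last j).ne]
      simp [hA, augEntry]
  have h2 : (A.updateCol (Fin.last n) fun i => x i ^ (n + 1)).det =
      (-1) ^ n * ((∏ i, x i) * alternant x fun j => n + 1 - 1 - j) := by
    have := alternant_add_const x (fun j => n + 1 - 1 - (j : ℕ)) 1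
    rw [pow_one] at this
    have h3 := alternant_comp_perm x (fun j => n + 1 - 1 - (j : ℕ) + 1) (finRotate (n + 1))
    rw [this, sign_finRotate, Nat.add_sub_cancel] at h3
    simp only [Units.val_pow_eq_pow_val, Units.val_neg, Units.val_one, Int.cast_pow, Int.cast_neg,
      Int.cast_one] at h3
    refine Eq.trans (congrArg Matrix.det ?_) h3
    ext i j
    induction j using Fin.lastCases with
    | last => simp
    | cast j =>
      rw [Matrix.updateCol_ne (Fin.castSucc_lt_last j).ne]
      simp only [hA, Matrix.of_apply, Function.comp_apply, Fin.val_castSucc]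
      rw [finRotate_apply, Fin.coeSucc_eq_succ, Fin.val_succ]
      congr 1
      omega
  rw [h1, Matrix.det_updateCol_add, Matrix.det_updateCol_smul, h2, Matrix.updateCol_eq_self]
  have h4 : ((-1 : R) ^ n) * (-1) ^ n = 1 := by rw [← mul_pow]; simp
  change alternant x _ + _ = _
  linear_combination (-(∏ i, x i) * alternant x fun j => n + 1 - 1 - (j : ℕ)) * h4

theorem mem_pow_of_one_sub_mul_mem {M : Ideal R} {a e : R} (he : e ∈ M) {k : ℕ}
    (h : (1 - e) * a ∈ M ^ k) : a ∈ M ^ k := by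
  have h1 : a = (∑ i ∈ Finset.range k, e ^ i) * ((1 - e) * a) + e ^ k * a := by
    have := geom_sum_mul e k
    linear_combination a * this
  rw [h1]
  exact add_mem (Ideal.mul_mem_left _ _ h) (Ideal.mul_mem_right _ _ (Ideal.pow_mem_pow he k))

/-- The truncated form of the character identity, multiplied by the Vandermonde determinant. -/
theorem boundedSum_mul_littlewoodProd_sub_mem [IsDomain R] {M : Ideal R} (N n p : ℕ)
    (x : Fin n → R) (hx : ∀ i, x i ∈ M) (hx1 : ∀ i, 1 + x i ≠ 0) :
    boundedSum N p x * littlewoodProd x - augDenominator p x ∈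
      M ^ (N + 1 + ∑ j : Fin n, (n - 1 - (j : ℕ))) := by
  have stable : ∀ {n : ℕ} (x : Fin n → R) (p : ℕ), n ≤ p →
      boundedSum N p x = boundedSum N n x ∧ augDenominator p x = augDenominator n x := by
    intro n x p hp
    refine ⟨?_, by rw [augDenominator_of_le hp, augDenominator_of_le le_rfl]⟩
    induction p, hp using Nat.le_induction with
    | base => rfl
    | succ p hp ih => rw [boundedSum_add_one_of_le hp, ih]
  induction n generalizing p with
  | zero =>
    rw [(stable x p p.zero_le).1, (stable x p p.zero_le).2, boundedSum_fin_zero]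
    simp [littlewoodProd, augDenominator]
  | succ n ih =>
    have small : ∀ p ≤ n, boundedSum N p x * littlewoodProd x - augDenominator p x ∈
        M ^ (N + 1 + ∑ j : Fin (n + 1), (n + 1 - 1 - (j : ℕ))) := by
      intro p hp
      have h : boundedSum N p x * littlewoodProd x - augDenominator p x =
          ∑ i : Fin (n + 1), (-1) ^ ((i : ℕ) + n) *
            ((1 - x i) * ∏ j, (1 - x i * x (i.succAbove j))) * ((∏ j, x (i.succAbove j)) *
            (boundedSum N p (x ∘ i.succAbove) * littlewoodProd (x ∘ i.succAbove) -
              augDenominator p (x ∘ i.succAbove))) := by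
        rw [boundedSum_succ hp, augDenominator_succ hp x hx1, Finset.sum_mul,
          ← Finset.sum_sub_distrib]
        refine Finset.sum_congr rfl fun i _ => ?_
        rw [littlewoodProd_succAbove x i]
        ring
      rw [h, sum_staircase_succ, add_left_comm, pow_add]
      refine Ideal.sum_mem _ fun i _ => Ideal.mul_mem_left _ _ (Ideal.mul_mem_mul ?_
        (ih p _ (fun j => hx _) fun j => hx1 _))
      simpa using Ideal.prod_mem_prod (s := Finset.univ) (I := fun _ : Fin n => M)
        fun j _ => hx (i.succAbove j)
    rcases Nat.lt_or_ge n p with hp | hp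
    · rw [(stable x p hp).1, (stable x p hp).2]
      refine mem_pow_of_one_sub_mul_mem (Ideal.prod_mem M (Finset.mem_univ 0) (hx 0)) ?_
      have := add_mem (small n le_rfl) (Ideal.mul_mem_right (littlewoodProd x) _
        (boundedSum_top (N := N) x hx))
      rw [augDenominator_last] at this
      convert this using 1
      ring
    · exact small p hp

end Congruence
section SelfConjugate

theorem lt_card_setOf_iff {P : ℕ → Prop} (hP : ∀ i j, i ≤ j → P j → P i) {n : ℕ} (hn : ¬ P n)
    (i : ℕ) : i < Nat.card {i : ℕ | P i} ↔ P i := by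
  have hex : ∃ c, ¬ P c := ⟨n, hn⟩
  have h : ∀ i, i ∈ Finset.range (Nat.find hex) ↔ P i := fun i => by
    rw [Finset.mem_range]
    refine ⟨fun hi => not_not.1 (Nat.find_min hex hi), fun hi => ?_⟩
    by_contra hc
    exact Nat.find_spec hex (hP _ _ (not_lt.1 hc) hi)
  rw [show Nat.card {i : ℕ | P i} = _ from Nat.subtype_card _ h, Finset.card_range,
    ← Finset.mem_range, h]

theorem lt_conjP_iff {F : ℕ → ℕ} (hF : Antitone F) {n : ℕ} (hn : F n = 0) (i j : ℕ) :
    i < conjP F j ↔ j < F i :=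
  lt_card_setOf_iff (P := fun i => j < F i) (fun _ _ hab h => h.trans_le (hF hab))
    (n := n) (by omega) i

theorem lt_prank_iff {F : ℕ → ℕ} (hF : Antitone F) {n : ℕ} (hn : F n = 0) (i : ℕ) :
    i < prank F ↔ i < F i :=
  lt_card_setOf_iff (P := fun i => i < F i)
    (fun _ _ hab h => (hab.trans_lt h).trans_le (hF hab)) (n := n) (by omega) i

/-- A self-conjugate partition with at most `n` parts, given by its infinite sequence of parts. -/
structure IsSelfConj (n : ℕ) (F : ℕ → ℕ) : Prop where
  anti : Antitone F
  symm : ∀ i j, j < F i ↔ i < F j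
  zero : F n = 0

theorem IsSelfConj.le {n : ℕ} {F : ℕ → ℕ} (h : IsSelfConj n F) (i : ℕ) : F i ≤ n := by
  by_contra hc
  have := (h.symm i n).1 (by omega)
  rw [h.zero] at this
  omega

theorem IsSelfConj.eq_zero {n : ℕ} {F : ℕ → ℕ} (h : IsSelfConj n F) {i : ℕ} (hi : n ≤ i) :
    F i = 0 :=
  Nat.le_zero.1 ((h.anti hi).trans_eq h.zero)

theorem IsSelfConj.conjP_eq {n : ℕ} {F : ℕ → ℕ} (h : IsSelfConj n F) : conjP F = F := by
  funext j
  refine eq_of_forall_lt_iff fun i => ?_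
  rw [lt_conjP_iff h.anti h.zero, h.symm]

theorem antitone_extN {n m : ℕ} {f : Fin n → Fin m} (hf : Antitone f) :
    Antitone (extN fun i => (f i : ℕ)) := by
  intro a b hab
  rcases Nat.lt_or_ge b n with hb | hb
  · rw [extN_of_lt _ hb, extN_of_lt _ (hab.trans_lt hb)]
    exact Fin.le_def.1 (hf (Fin.mk_le_mk.2 hab))
  · rw [extN_of_le _ hb]
    exact Nat.zero_le _

theorem IsSCBox.isSelfConj {n : ℕ} {f : Fin n → Fin (n + 1)} (h : IsSCBox n f) :
    IsSelfConj n (extN fun i => (f i : ℕ)) where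
  anti := antitone_extN h.1
  symm i j := by
    rw [← lt_conjP_iff (antitone_extN h.1) (extN_of_le _ le_rfl) i j, h.2]
  zero := extN_of_le _ le_rfl

theorem IsSelfConj.exists_isSCBox {n : ℕ} {F : ℕ → ℕ} (h : IsSelfConj n F) :
    ∃ f : Fin n → Fin (n + 1), IsSCBox n f ∧ (extN fun i => (f i : ℕ)) = F := by
  have he : (extN fun i : Fin n => ((⟨F i, Nat.lt_succ_of_le (h.le i)⟩ : Fin (n + 1)) : ℕ)) = F := by
    funext i
    rcases Nat.lt_or_ge i n with hi | hi
    · rw [extN_of_lt _ hi]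
    · rw [extN_of_le _ hi, h.eq_zero hi]
  refine ⟨fun i => ⟨F i, Nat.lt_succ_of_le (h.le i)⟩, ⟨fun a b hab => ?_, ?_⟩, he⟩
  · exact Fin.mk_le_mk.2 (h.anti (Fin.le_def.1 hab))
  · rw [he, h.conjP_eq]

theorem IsSelfConj.psize_add_prank {n : ℕ} {F : ℕ → ℕ} (h : IsSelfConj n F) :
    psize F + prank F = 2 * ∑ i ∈ Finset.range n, (F i - i) := by
  have h1 : psize F = ∑ i ∈ Finset.range n, F i := by
    refine finsum_eq_sum_of_support_subset _ fun i hi => ?_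
    by_contra hc
    exact hi (h.eq_zero (by simpa using hc))
  have h2 : prank F = ∑ i ∈ Finset.range n, if i < F i then 1 else 0 := by
    rw [← Finset.card_filter]
    refine Nat.subtype_card _ fun i => ?_
    rw [Finset.mem_filter, Finset.mem_range, Set.mem_ofPred_eq, and_iff_right_iff_imp]
    exact fun hi => hi.trans_le (h.le i)
  have h3 : ∑ i ∈ Finset.range n, min i (F i) = ∑ j ∈ Finset.range n, (F j - (j + 1)) := by
    have ha : ∀ i ∈ Finset.range n, min i (F i) =
        ∑ j ∈ Finset.range n, if j < i ∧ j < F i then 1 else 0 := by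
      intro i hi
      rw [← Finset.card_filter, ← Finset.card_range (min i (F i))]
      congr 1
      ext j
      simp only [Finset.mem_range, Finset.mem_filter] at hi ⊢
      omega
    have hb : ∀ j ∈ Finset.range n, F j - (j + 1) =
        ∑ i ∈ Finset.range n, if j < i ∧ j < F i then 1 else 0 := by
      intro j hj
      rw [← Finset.card_filter, ← Nat.card_Ico]
      congr 1
      ext i
      have := h.le j
      simp only [Finset.mem_range, Finset.mem_filter, Finset.mem_Ico, h.symm i j]
      omega
    rw [Finset.sum_congr rfl ha, Finset.sum_congr rfl hb, Finset.sum_comm]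
  have h4 : psize F = ∑ i ∈ Finset.range n, (F i - i) + ∑ i ∈ Finset.range n, (F i - (i + 1)) := by
    rw [h1, ← h3, ← Finset.sum_add_distrib]
    exact Finset.sum_congr rfl fun i _ => by omega
  rw [h4, h2, add_assoc, ← Finset.sum_add_distrib, two_mul]
  congr 1
  refine Finset.sum_congr rfl fun i _ => ?_
  split_ifs <;> omega

theorem conjAugP_of_lt {n p : ℕ} {F : ℕ → ℕ} (h : IsSelfConj n F) {k : ℕ} (hk : k < F k) :
    conjAugP p F k = F k := by
  rw [conjAugP, frob, if_pos ((lt_prank_iff h.anti h.zero k).2 hk)]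
  omega

theorem lt_conjAugP_iff {n p : ℕ} {F : ℕ → ℕ} (h : IsSelfConj n F) {i : ℕ} (hi : ¬ i < F i)
    (k : ℕ) : k < conjAugP p F i ↔ k < F k ∧ i < F k + p := by
  rw [conjAugP, frob, if_neg fun hc => hi ((lt_prank_iff h.anti h.zero i).1 hc)]
  have hm : ∀ k, k ∈ (Finset.range (prank F)).filter (fun k => i ≤ F k - (k + 1) + p + k) ↔
      k < F k ∧ i < F k + p := fun k => by
    rw [Finset.mem_filter, Finset.mem_range, lt_prank_iff h.anti h.zero]
    omega
  rw [← Nat.subtype_card _ hm]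
  refine lt_card_setOf_iff (P := fun k => k < F k ∧ i < F k + p) (fun a b hab hb => ?_)
    (n := n) (by simp [h.zero]) k
  have := h.anti hab
  omega

theorem conjAugP_eq_zero_iff {n p : ℕ} {F : ℕ → ℕ} (h : IsSelfConj n F) :
    conjAugP p F n = 0 ↔ ∀ k, k < F k → F k + p ≤ n := by
  have hl := lt_conjAugP_iff (p := p) h (i := n) (by simp [h.zero])
  constructor
  · intro h0 k hk
    by_contra hc
    have := (hl k).2 ⟨hk, by omega⟩
    omega
  · intro hk
    by_contra hc
    obtain ⟨h1, h2⟩ := (hl 0).1 (by omega)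
    have := hk 0 h1
    omega

theorem antitone_conjAugP {n p : ℕ} {F : ℕ → ℕ} (h : IsSelfConj n F) :
    Antitone (conjAugP p F) := by
  intro i j hij
  by_contra hc
  rw [not_le] at hc
  have hF := h.anti hij
  by_cases hj : j < F j
  · rw [conjAugP_of_lt h hj, conjAugP_of_lt h (show i < F i by omega)] at hc
    omega
  · obtain ⟨h1, h2⟩ := (lt_conjAugP_iff h hj _).1 hc
    by_cases hi : i < F i
    · rw [conjAugP_of_lt h hi] at h1
      have := h.anti hi.le
      omega
    · exact lt_irrefl _ ((lt_conjAugP_iff h hi _).2 ⟨h1, by omega⟩)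

/-- The set `α + p` for a self-conjugate partition `(α | α)`. -/
noncomputable def armSet (n p : ℕ) (F : ℕ → ℕ) : Finset (Fin n) :=
  Finset.univ.filter fun j => ∃ k, k < F k ∧ F k + p = j + k + 1

theorem mem_armSet {n p : ℕ} {F : ℕ → ℕ} {j : Fin n} :
    j ∈ armSet n p F ↔ ∃ k, k < F k ∧ F k + p = j + k + 1 := by
  simp [armSet]

theorem le_of_mem_armSet {n p : ℕ} {F : ℕ → ℕ} {j : Fin n} (hj : j ∈ armSet n p F) :
    p ≤ j := by
  obtain ⟨k, h1, h2⟩ := mem_armSet.1 hj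
  omega

theorem sum_armSet {n p : ℕ} {F : ℕ → ℕ} (h : IsSelfConj n F) (h0 : conjAugP p F n = 0) :
    ∑ j ∈ armSet n p F, ((j : ℕ) + 1 - p) = (psize F + prank F) / 2 := by
  rw [h.psize_add_prank, Nat.mul_div_cancel_left _ two_pos,
    ← Finset.sum_filter_of_ne (p := fun i => i < F i) fun i _ hi => by omega]
  rw [conjAugP_eq_zero_iff h] at h0
  symm
  refine Finset.sum_bij
    (fun i hi => ⟨F i + p - i - 1, by
      have hi := (Finset.mem_filter.1 hi).2
      have := h0 i hi
      omega⟩) (fun i hi => ?_) (fun i hi i' hi' hii => ?_) (fun j hj => ?_) (fun i hi => ?_)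
  · have hi := (Finset.mem_filter.1 hi).2
    exact mem_armSet.2 ⟨i, hi, by dsimp only; omega⟩
  · have hi := (Finset.mem_filter.1 hi).2
    have hi' := (Finset.mem_filter.1 hi').2
    rw [Fin.mk.injEq] at hii
    rcases lt_trichotomy i i' with hlt | heq | hlt
    · have := h.anti hlt.le
      omega
    · exact heq
    · have := h.anti hlt.le
      omega
  · obtain ⟨k, h1, h2⟩ := mem_armSet.1 hj
    refine ⟨k, Finset.mem_filter.2 ⟨Finset.mem_range.2 (h1.trans_le (h.le k)), h1⟩, Fin.ext ?_⟩
    dsimp only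
    omega
  · have hi := (Finset.mem_filter.1 hi).2
    dsimp only
    omega

theorem lt_and_le_of_armSet_eq {n p k : ℕ} {F F' : ℕ → ℕ} (h : IsSelfConj n F)
    (h' : IsSelfConj n F') (h0 : conjAugP p F n = 0) (hs : armSet n p F = armSet n p F')
    (ih : ∀ a < k, a < F' a → F a = F' a) (hk : k < F k) : k < F' k ∧ F k ≤ F' k := by
  have hk0 := (conjAugP_eq_zero_iff h).1 h0 k hk
  have hmem : (⟨F k + p - k - 1, by omega⟩ : Fin n) ∈ armSet n p F' :=
    hs ▸ mem_armSet.2 ⟨k, hk, by dsimp only; omega⟩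
  obtain ⟨a, h1, h2⟩ := mem_armSet.1 hmem
  dsimp only at h2
  rcases Nat.lt_or_ge a k with hak | hak
  · have := ih a hak h1
    have := h.anti hak.le
    omega
  · have := h'.anti hak
    omega

theorem eq_of_armSet_eq {n p : ℕ} {F F' : ℕ → ℕ} (h : IsSelfConj n F) (h' : IsSelfConj n F')
    (h0 : conjAugP p F n = 0) (h0' : conjAugP p F' n = 0)
    (hs : armSet n p F = armSet n p F') : F = F' := by
  have key : ∀ k, (k < F k → F k = F' k) ∧ (k < F' k → F k = F' k) := by
    intro k
    induction k using Nat.strong_induction_on with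
    | _ k ih =>
      have ha := lt_and_le_of_armSet_eq h h' h0 hs fun a hak => (ih a hak).2
      have hb := lt_and_le_of_armSet_eq h' h h0' hs.symm fun a hak hal => ((ih a hak).1 hal).symm
      exact ⟨fun hk => le_antisymm (ha hk).2 (hb (ha hk).1).2,
        fun hk => le_antisymm (ha (hb hk).1).2 (hb hk).2⟩
  funext i
  refine eq_of_forall_lt_iff fun j => ?_
  by_cases hi : i < F i ∨ i < F' i
  · rw [hi.elim (key i).1 (key i).2]
  · rw [h.symm, h'.symm]
    constructor
    · intro hj
      rw [← (key j).1 (by have := (h.symm i j).2 hj; omega)]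
      exact hj
    · intro hj
      rw [(key j).2 (by have := (h'.symm i j).2 hj; omega)]
      exact hj

/-- The cell `(i, j)` lies in the self-conjugate diagram of rank `r` with arms `α`. -/
def IsHookCell (r : ℕ) (α : ℕ → ℕ) (i j : ℕ) : Prop :=
  min i j < r ∧ max i j ≤ α (min i j) + min i j

theorem IsHookCell.mono {r : ℕ} {α : ℕ → ℕ} (hα : ∀ k k', k < k' → k' < r → α k' < α k)
    {i j i' j' : ℕ} (hi : i' ≤ i) (hj : j' ≤ j) (h : IsHookCell r α i j) :
    IsHookCell r α i' j' := by
  have hβ : ∀ k k', k ≤ k' → k' < r → α k' + k' ≤ α k + k := by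
    intro k k' hk
    induction k', hk using Nat.le_induction with
    | base => exact fun _ => le_rfl
    | succ m hm ih =>
      intro hr
      have := ih (by omega)
      have := hα m (m + 1) (by omega) hr
      omega
  obtain ⟨h1, h2⟩ := h
  have := hβ (min i' j') (min i j) (by omega) h1
  exact ⟨by omega, by omega⟩

theorem exists_isSelfConj_of_arms {n r : ℕ} {α : ℕ → ℕ}
    (hα : ∀ k k', k < k' → k' < r → α k' < α k) (h0 : 0 < r → α 0 < n) :
    ∃ F, IsSelfConj n F ∧ ∀ k, (k < F k ↔ k < r) ∧ (k < r → F k = α k + k + 1) := by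
  have hn : ∀ i, ¬ IsHookCell r α i n := fun i hi => by
    obtain ⟨h1, h2⟩ := hi.mono hα i.zero_le le_rfl
    rw [Nat.zero_min] at h1 h2
    have := h0 h1
    omega
  have hF : ∀ i j, j < Nat.card {j : ℕ | IsHookCell r α i j} ↔ IsHookCell r α i j := fun i =>
    lt_card_setOf_iff (P := IsHookCell r α i) (fun _ _ hab h => h.mono hα le_rfl hab) (hn i)
  have hsymm : ∀ i j, IsHookCell r α i j ↔ IsHookCell r α j i := fun i j => by
    rw [IsHookCell, IsHookCell, min_comm, max_comm]
  have hdiag : ∀ k, IsHookCell r α k k ↔ k < r := fun k => by simp [IsHookCell]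
  refine ⟨fun i => Nat.card {j : ℕ | IsHookCell r α i j}, ⟨fun a b hab => ?_, fun i j => ?_, ?_⟩,
    fun k => ⟨by rw [hF, hdiag], fun hk => ?_⟩⟩
  · refine le_of_forall_lt fun j hj => ?_
    rw [hF] at hj ⊢
    exact hj.mono hα hab le_rfl
  · rw [hF, hF, hsymm]
  · by_contra hc
    exact hn 0 ((hsymm _ _).1 ((hF n 0).1 (Nat.pos_of_ne_zero hc)))
  · refine eq_of_forall_lt_iff fun j => ?_
    rw [hF]
    rcases Nat.lt_or_ge j k with hj | hj
    · exact iff_of_true (((hdiag k).2 hk).mono hα le_rfl hj.le) (by omega)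
    · rw [IsHookCell, min_eq_left hj, max_eq_right hj]
      omega

theorem exists_armSet_eq {n p : ℕ} {T : Finset (Fin n)} (hT : ∀ j ∈ T, p ≤ (j : ℕ)) :
    ∃ F, IsSelfConj n F ∧ conjAugP p F n = 0 ∧ armSet n p F = T := by
  set τ := T.orderEmbOfFin rfl
  have hτ : ∀ k, p ≤ (τ k : ℕ) := fun k => hT _ (T.orderEmbOfFin_mem rfl k)
  set α : ℕ → ℕ := fun k => if h : k < T.card then τ (Fin.rev ⟨k, h⟩) - p else 0 with hαdef
  have hα : ∀ k (h : k < T.card), α k + p = τ (Fin.rev ⟨k, h⟩) := fun k h => by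
    have := hτ (Fin.rev ⟨k, h⟩)
    simp only [hαdef, dif_pos h]
    omega
  have hanti : ∀ k k', k < k' → k' < T.card → α k' < α k := fun k k' hk hk' => by
    have h1 := hα k (hk.trans hk')
    have h2 := hα k' hk'
    have h3 : τ (Fin.rev ⟨k', hk'⟩) < τ (Fin.rev ⟨k, hk.trans hk'⟩) :=
      τ.strictMono (Fin.rev_lt_rev.2 (Fin.mk_lt_mk.2 hk))
    rw [Fin.lt_def] at h3
    omega
  obtain ⟨F, hF, hFα⟩ := exists_isSelfConj_of_arms (n := n) hanti fun h => by
    have := hα 0 h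
    omega
  refine ⟨F, hF, (conjAugP_eq_zero_iff hF).2 fun k hk => ?_, ?_⟩
  · have hr : 0 < T.card := k.zero_le.trans_lt ((hFα k).1.1 hk)
    have := hF.anti k.zero_le
    have := (hFα 0).2 hr
    have := hα 0 hr
    omega
  · ext j
    rw [mem_armSet]
    constructor
    · rintro ⟨k, h1, h2⟩
      have hk := (hFα k).1.1 h1
      have h3 := (hFα k).2 hk
      have h4 := hα k hk
      rw [show j = τ (Fin.rev ⟨k, hk⟩) from Fin.ext (by omega)]
      exact T.orderEmbOfFin_mem rfl _
    · intro hj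
      obtain ⟨k, hk⟩ : j ∈ Set.range τ := by
        rw [Finset.range_orderEmbOfFin]
        exact hj
      refine ⟨Fin.rev k, (hFα _).1.2 (Fin.rev k).2, ?_⟩
      rw [(hFα _).2 (Fin.rev k).2]
      have := hα (Fin.rev k) (Fin.rev k).2
      rw [Fin.eta, Fin.rev_rev, hk] at this
      omega

end SelfConjugate
section Expansion

variable {R : Type*} [CommRing R]

/-- The exponents `n - 1 - j`, replaced by `n + j - p` for `j` in `T`. -/
noncomputable def flipExponent {n : ℕ} (p : ℕ) (T : Finset (Fin n)) (j : Fin n) : ℕ :=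
  if j ∈ T then n + j - p else n - 1 - j

theorem augDenominator_eq_sum {n : ℕ} (p : ℕ) (x : Fin n → R) :
    augDenominator p x = ∑ T ∈ Finset.univ.filter (fun T : Finset (Fin n) => ∀ j ∈ T, p ≤ (j : ℕ)),
      (∏ _j ∈ T, -(-1) ^ p) * alternant x (flipExponent p T) := by
  have h1 : augDenominator p x = Matrix.detRowAlternating
      ((fun j i : Fin n => if (j : ℕ) < p then (0 : R) else -(-1) ^ p * x i ^ (n + j - p)) +
        fun j i : Fin n => x i ^ (n - 1 - (j : ℕ))) := by
    rw [augDenominator, ← Matrix.det_transpose]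
    refine congrArg Matrix.detRowAlternating ?_
    funext j i
    simp only [Matrix.transpose_apply, Matrix.of_apply, augEntry, Pi.add_apply]
    split_ifs <;> ring
  rw [h1, ← AlternatingMap.coe_multilinearMap, MultilinearMap.map_add_univ, Finset.sum_filter]
  refine Finset.sum_congr rfl fun T _ => ?_
  split_ifs with hT
  · rw [alternant, ← Matrix.det_transpose]
    have : (T.piecewise (fun j i : Fin n => if (j : ℕ) < p then (0 : R) else -(-1) ^ p * x i ^ (n + j - p))
        fun j i : Fin n => x i ^ (n - 1 - (j : ℕ))) = fun j =>
        (if j ∈ T then -(-1) ^ p else 1 : R) •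
          (fun i => x i ^ flipExponent p T j : Fin n → R) := by
      funext j i
      by_cases hj : j ∈ T
      · simp [hj, flipExponent, (hT j hj).not_gt]
      · simp [hj, flipExponent]
    refine (congrArg _ this).trans ((MultilinearMap.map_smul_univ _ _ _).trans ?_)
    rw [Finset.prod_ite_mem, Finset.univ_inter]
    rfl
  · push Not at hT
    obtain ⟨j, hj, hjp⟩ := hT
    refine MultilinearMap.map_coord_zero _ j ?_
    funext i
    simp [hj, hjp]

theorem diffProd_comp_perm {n : ℕ} (e : Fin n → ℤ) (σ : Equiv.Perm (Fin n)) :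
    ∏ i, ∏ j ∈ Finset.Ioi i, (e (σ i) - e (σ j)) =
      (Equiv.Perm.sign σ : ℤ) * ∏ i, ∏ j ∈ Finset.Ioi i, (e i - e j) := by
  have h : ∀ e : Fin n → ℤ, ∏ i, ∏ j ∈ Finset.Ioi i, (e i - e j) =
      (Matrix.vandermonde fun i => -e i).det := fun e => by
    rw [Matrix.det_vandermonde]
    simp only [neg_sub_neg]
  rw [h fun i => e (σ i), h e]
  exact Matrix.det_permute σ (Matrix.vandermonde fun i => -e i)

theorem exists_diffProd_flipExponent {n p : ℕ} {T : Finset (Fin n)} (hT : ∀ j ∈ T, p ≤ (j : ℕ)) :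
    ∃ c : ℤ, 0 ≤ c ∧ ∏ i, ∏ j ∈ Finset.Ioi i,
      ((flipExponent p T i : ℤ) - flipExponent p T j) = (∏ j ∈ T, (-1) ^ (j : ℕ)) * c := by
  refine ⟨∏ i, ∏ j ∈ Finset.Ioi i, |(flipExponent p T i : ℤ) - flipExponent p T j|,
    Finset.prod_nonneg fun i _ => Finset.prod_nonneg fun j _ => abs_nonneg _, ?_⟩
  have h : ∀ i, ∀ j ∈ Finset.Ioi i, (flipExponent p T i : ℤ) - flipExponent p T j =
      (if j ∈ T then -1 else 1) * |(flipExponent p T i : ℤ) - flipExponent p T j| := by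
    intro i j hij
    have hij := Fin.lt_def.1 (Finset.mem_Ioi.1 hij)
    unfold flipExponent
    by_cases hj : j ∈ T
    · have hpj := hT j hj
      rw [if_pos hj, if_pos hj, abs_of_nonpos]
      · ring
      · by_cases hi : i ∈ T
        · have hpi := hT i hi
          rw [if_pos hi]
          omega
        · rw [if_neg hi]
          omega
    · rw [if_neg hj, if_neg hj, one_mul, abs_of_nonneg]
      by_cases hi : i ∈ T
      · have hpi := hT i hi
        rw [if_pos hi]
        omega
      · rw [if_neg hi]
        omega
  rw [Finset.prod_congr rfl fun i _ => Finset.prod_congr rfl (h i)]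
  simp only [Finset.prod_mul_distrib]
  congr 1
  rw [Finset.prod_comm' (t' := Finset.univ) (s' := fun j => Finset.Iio j) (by simp)]
  simp only [Finset.prod_const, Fin.card_Iio]
  rw [← Finset.prod_subset (Finset.subset_univ T) fun j _ hj => by rw [if_neg hj, one_pow]]
  exact Finset.prod_congr rfl fun j hj => by rw [if_pos hj]

theorem alternant_eq_of_range_subset {n p : ℕ} {T : Finset (Fin n)} (hT : ∀ j ∈ T, p ≤ (j : ℕ))
    (x : Fin n → R) {l : Fin n → ℕ} (hl : StrictAnti l) (hr : ∀ i, ∃ j, l i = flipExponent p T j) :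
    alternant x l = (∏ j ∈ T, (-1) ^ (j : ℕ)) * alternant x (flipExponent p T) := by
  choose s hs using hr
  have hinj : Function.Injective s := fun a b hab => hl.injective (by rw [hs, hs, hab])
  set σ : Equiv.Perm (Fin n) := Equiv.ofBijective s (Finite.injective_iff_bijective.1 hinj)
  have hσ : l = flipExponent p T ∘ σ := funext hs
  have h1 := diffProd_comp_perm (fun i => (flipExponent p T i : ℤ)) σ
  obtain ⟨c, hc, h2⟩ := exists_diffProd_flipExponent hT
  rw [h2] at h1
  have hpos : 0 < ∏ i, ∏ j ∈ Finset.Ioi i,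
      ((flipExponent p T (σ i) : ℤ) - flipExponent p T (σ j)) := by
    refine Finset.prod_pos fun i _ => Finset.prod_pos fun j hj => ?_
    have := hl (Finset.mem_Ioi.1 hj)
    rw [hσ] at this
    simp only [Function.comp_apply] at this
    omega
  rw [h1] at hpos
  have h3 : (∏ j ∈ T, (-1) ^ (j : ℕ) : ℤ) = (Equiv.Perm.sign σ : ℤ) := by
    rw [Finset.prod_pow_eq_pow_sum] at hpos ⊢
    rcases neg_one_pow_eq_or ℤ (∑ j ∈ T, (j : ℕ)) with h | h <;>
    rcases Int.units_eq_one_or (Equiv.Perm.sign σ) with h' | h' <;>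
    rw [h, h'] at hpos ⊢ <;> simp at hpos ⊢ <;> omega
  rw [hσ, alternant_comp_perm, ← h3]
  push_cast
  rfl

theorem alternant_conjAugP {n p : ℕ} {F : ℕ → ℕ} (h : IsSelfConj n F)
    (h0 : conjAugP p F n = 0) (x : Fin n → R) :
    (-1) ^ ((psize F + prank F) / 2) * alternant x (fun j => conjAugP p F j + (n - 1 - j)) =
      (∏ _j ∈ armSet n p F, -(-1) ^ p) * alternant x (flipExponent p (armSet n p F)) := by
  have hanti : StrictAnti fun j : Fin n => conjAugP p F j + (n - 1 - j) := fun i j hij => by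
    have := antitone_conjAugP (p := p) h (Fin.lt_def.1 hij).le
    have := Fin.lt_def.1 hij
    dsimp only
    omega
  rw [alternant_eq_of_range_subset (p := p) (T := armSet n p F) (fun j hj => le_of_mem_armSet hj)
    x hanti, ← sum_armSet h h0, ← Finset.prod_pow_eq_pow_sum, ← mul_assoc,
    ← Finset.prod_mul_distrib]
  · congr 1
    refine Finset.prod_congr rfl fun j hj => ?_
    have hpj := le_of_mem_armSet hj
    obtain ⟨a, ha⟩ := Nat.exists_eq_add_of_le hpj
    rw [ha, show p + a + 1 - p = a + 1 by omega, ← pow_add,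
      show a + 1 + (p + a) = 2 * a + (p + 1) by ring, pow_add, pow_mul]
    simp [pow_succ]
  · intro i
    rw [conjAugP_eq_zero_iff h] at h0
    by_cases hi : (i : ℕ) < F i
    · have := h0 i hi
      refine ⟨⟨F i + p - i - 1, by omega⟩, ?_⟩
      rw [flipExponent, if_pos (mem_armSet.2 ⟨i, hi, by dsimp only; omega⟩), conjAugP_of_lt h hi]
      dsimp only
      omega
    · have hle : conjAugP p F i ≤ i := by
        by_contra hc
        exact hi ((lt_conjAugP_iff h hi _).1 (not_le.1 hc)).1
      refine ⟨⟨i - conjAugP p F i, by omega⟩, ?_⟩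
      rw [flipExponent, if_neg]
      · dsimp only
        omega
      · rw [mem_armSet]
        rintro ⟨k, h1, h2⟩
        dsimp only at h2
        have := lt_conjAugP_iff (p := p) h hi k
        omega

end Expansion

section JacobiTrudi

variable {R : Type*} [CommRing R]

theorem prod_mk_pow_eq_mk_sum {n : ℕ} (x : Fin n → R) :
    ∏ i, PowerSeries.mk (fun k => x i ^ k) =
      PowerSeries.mk fun k => ∑ d ∈ Finset.Nat.antidiagonalTuple n k, ∏ i, x i ^ d i := by
  ext k
  rw [PowerSeries.coeff_prod, PowerSeries.coeff_mk]
  refine Finset.sum_equiv Finsupp.equivFunOnFinite (fun d => ?_) fun d _ => by simp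
  simp [Finset.mem_finsuppAntidiag, Finset.Nat.mem_antidiagonalTuple]

theorem one_sub_mul_mk_pow (a : R) :
    (1 - PowerSeries.C a * PowerSeries.X) * PowerSeries.mk (fun k => a ^ k) = 1 := by
  ext k
  rw [sub_mul, one_mul, mul_assoc, map_sub, PowerSeries.coeff_C_mul]
  cases k with
  | zero => simp
  | succ k => simp [PowerSeries.coeff_succ_X_mul, PowerSeries.coeff_one, pow_succ']

/-- The polynomial `∏ (1 - x l * t)` over all `l ≠ k`. -/
noncomputable def omitProd {n : ℕ} (x : Fin n → R) (k : Fin n) : Polynomial R :=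
  ∏ l ∈ Finset.univ.erase k, (1 - Polynomial.C (x l) * Polynomial.X)

theorem omitProd_coeff_eq_zero {n : ℕ} (x : Fin n → R) (k : Fin n) {b : ℕ} (hb : n ≤ b) :
    (omitProd x k).coeff b = 0 := by
  refine Polynomial.coeff_eq_zero_of_natDegree_lt ?_
  have h : (omitProd x k).natDegree ≤ ∑ l ∈ Finset.univ.erase k, 1 :=
    (Polynomial.natDegree_prod_le _ _).trans (Finset.sum_le_sum fun l _ => by compute_degree)
  rw [Finset.sum_const, Finset.card_erase_of_mem (Finset.mem_univ k), Finset.card_univ,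
    Fintype.card_fin, smul_eq_mul, mul_one] at h
  have := k.2
  omega

theorem pow_eq_sum_omitProd {n : ℕ} (k : Fin n) (L : ℕ) :
    (X k : MvPolynomial (Fin n) ℤ) ^ L =
      ∑ j : Fin n, (omitProd X k).coeff (n - 1 - j) * hInt n ((L : ℤ) - (n - 1 - j : ℕ)) := by
  have h1 : ((omitProd X k : Polynomial (MvPolynomial (Fin n) ℤ)) :
      PowerSeries (MvPolynomial (Fin n) ℤ)) *
      PowerSeries.mk (hpoly n) = PowerSeries.mk fun a => X k ^ a := by
    have : PowerSeries.mk (hpoly n) = ∏ i : Fin n, PowerSeries.mk fun a => X i ^ a :=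
      (prod_mk_pow_eq_mk_sum X).symm
    rw [this, ← Finset.mul_prod_erase _ _ (Finset.mem_univ k), mul_left_comm, omitProd,
      ← Polynomial.coeToPowerSeries.ringHom_apply, map_prod, ← Finset.prod_mul_distrib]
    rw [Finset.prod_eq_one, mul_one]
    intro l _
    simpa using one_sub_mul_mk_pow (X l : MvPolynomial (Fin n) ℤ)
  have h2 := congrArg (PowerSeries.coeff L) h1
  rw [PowerSeries.coeff_mul, PowerSeries.coeff_mk] at h2
  simp only [Polynomial.coeff_coe, PowerSeries.coeff_mk] at h2
  rw [← h2, Finset.Nat.sum_antidiagonal_eq_sum_range_succ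
    (fun b a => (omitProd X k).coeff b * hpoly n a)]
  set t : ℕ → MvPolynomial (Fin n) ℤ := fun b =>
    (omitProd X k).coeff b * hInt n ((L : ℤ) - b) with ht
  have h3 : ∑ j : Fin n, t (n - 1 - j) = ∑ b ∈ Finset.range n, t b := by
    rw [Finset.sum_range, ← Equiv.sum_comp Fin.revPerm]
    refine Finset.sum_congr rfl fun j _ => congrArg t ?_
    simp only [Fin.revPerm_apply, Fin.val_rev]
    omega
  have h4 : ∀ b ∈ Finset.range (L + 1), (omitProd X k).coeff b * hpoly n (L - b) = t b := by
    intro b hb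
    rw [Finset.mem_range] at hb
    simp only [ht]
    rw [hInt, if_pos (by omega)]
    congr 2
    omega
  rw [h3, Finset.sum_congr rfl h4]
  rw [Finset.sum_subset (Finset.range_mono (show L + 1 ≤ L + 1 + n by omega)),
    Finset.sum_subset (Finset.range_mono (show n ≤ L + 1 + n by omega))]
  · intro b _ hb
    rw [Finset.mem_range, not_lt] at hb
    simp only [ht]
    rw [omitProd_coeff_eq_zero X k hb, zero_mul]
  · intro b _ hb
    rw [Finset.mem_range, not_lt] at hb
    rw [hInt, if_neg (by omega), mul_zero]

theorem alternant_eq_det_mul (n : ℕ) (lam : ℕ → ℕ) :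
    alternant (X : Fin n → MvPolynomial (Fin n) ℤ) (fun j => lam j + (n - 1 - j)) =
      (Matrix.of fun k j : Fin n => (omitProd X k).coeff (n - 1 - j)).det *
        (Matrix.of fun i j : Fin n => hInt n ((lam i : ℤ) + j - i)).det := by
  rw [← Matrix.det_transpose (Matrix.of fun i j : Fin n => hInt n ((lam i : ℤ) + j - i)),
    ← Matrix.det_mul, alternant]
  congr 1
  ext1 k i
  rw [Matrix.of_apply, pow_eq_sum_omitProd, Matrix.mul_apply]
  refine Finset.sum_congr rfl fun j _ => ?_
  simp only [Matrix.of_apply, Matrix.transpose_apply]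
  congr 2
  omega

theorem hInt_zero (n : ℕ) : hInt n 0 = 1 := by
  simp [hInt, hpoly, Finset.Nat.antidiagonalTuple_zero_right]

theorem det_hInt_zero (n : ℕ) :
    (Matrix.of fun i j : Fin n => hInt n (((0 : ℕ) : ℤ) + j - i)).det = 1 := by
  rw [Matrix.det_of_isUpperTriangular]
  · exact Finset.prod_eq_one fun i _ => by simp [hInt_zero]
  · intro i j hij
    have : (j : ℕ) < i := hij
    rw [Matrix.of_apply, hInt, if_neg (by omega)]

/-- The bialternant formula. -/
theorem schur_mul_alternant {n : ℕ} {lam : ℕ → ℕ} (h : lam n = 0) :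
    schur n lam * alternant (X : Fin n → MvPolynomial (Fin n) ℤ) (fun j => n - 1 - j) =
      alternant X fun j => lam j + (n - 1 - j) := by
  have h0 := alternant_eq_det_mul n fun _ => 0
  simp only [zero_add] at h0
  have h1 := det_hInt_zero n
  simp only [Nat.cast_zero, zero_add] at h0 h1
  rw [h1, mul_one] at h0
  rw [alternant_eq_det_mul, h0, schur, if_pos h, mul_comm]

end JacobiTrudi

theorem sum_selfConj_mul_alternant (n p : ℕ) :
    (∑ f : {f : Fin n → Fin (n + 1) // IsSCBox n f},
        ((-1 : MvPolynomial (Fin n) ℤ) ^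
            ((psize (extN fun i => ((f : Fin n → Fin (n + 1)) i : ℕ)) +
              prank (extN fun i => ((f : Fin n → Fin (n + 1)) i : ℕ))) / 2)) *
          schur n (conjAugP p (extN fun i => ((f : Fin n → Fin (n + 1)) i : ℕ)))) *
      alternant X (fun j => n - 1 - j) = augDenominator p X := by
  rw [Finset.sum_mul, augDenominator_eq_sum,
    ← Finset.sum_filter_of_ne (p := fun f : {f : Fin n → Fin (n + 1) // IsSCBox n f} =>
      conjAugP p (extN fun i => (f.1 i : ℕ)) n = 0) fun f _ hf => ?_]
  · refine Finset.sum_nbij (fun f => armSet n p (extN fun i => (f.1 i : ℕ)))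
      (fun f _ => ?_) (fun f hf f' hf' hff => ?_) (fun T hT => ?_) fun f hf => ?_
    · exact Finset.mem_filter.2 ⟨Finset.mem_univ _, fun j hj => le_of_mem_armSet hj⟩
    · have h := eq_of_armSet_eq f.2.isSelfConj f'.2.isSelfConj (Finset.mem_filter.1 hf).2
        (Finset.mem_filter.1 hf').2 hff
      refine Subtype.ext (funext fun i => Fin.ext ?_)
      have := congrFun h i
      rwa [extN_coe, extN_coe] at this
    · obtain ⟨F, hF, h0, rfl⟩ := exists_armSet_eq (Finset.mem_filter.1 hT).2
      obtain ⟨f, hf, rfl⟩ := hF.exists_isSCBox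
      exact ⟨⟨f, hf⟩, Finset.mem_filter.2 ⟨Finset.mem_univ _, h0⟩, rfl⟩
    · have h0 := (Finset.mem_filter.1 hf).2
      rw [mul_assoc, schur_mul_alternant h0, alternant_conjAugP f.2.isSelfConj h0]
  · by_contra hc
    rw [schur, if_neg hc, mul_zero, zero_mul] at hf
    exact hf rfl

theorem sum_schur_mul_alternant (n p N : ℕ) :
    (∑ g : {g : Fin p → Fin (N + 1) // Antitone g}, schur n (extN fun i => (g.1 i : ℕ))) *
      alternant X (fun j => n - 1 - j) = boundedSum N p X := by
  rw [Finset.sum_mul, boundedSum]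
  refine Finset.sum_congr rfl fun g _ => ?_
  split_ifs with h
  · exact schur_mul_alternant h
  · rw [schur, if_neg h, zero_mul]

section Homogeneous

variable {σ R : Type*} [CommRing R]

theorem homogeneousComponent_mul_of_isHomogeneous {f a : MvPolynomial σ R} {K : ℕ}
    (ha : a.IsHomogeneous K) (m : ℕ) :
    homogeneousComponent (m + K) (f * a) = homogeneousComponent m f * a := by
  conv_lhs => rw [← sum_homogeneousComponent f, Finset.sum_mul, map_sum]
  have h : ∀ i, homogeneousComponent (m + K) (homogeneousComponent i f * a) =
      if i = m then homogeneousComponent m f * a else 0 := fun i => by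
    rw [homogeneousComponent_of_mem ((homogeneousComponent_isHomogeneous i f).mul ha)]
    by_cases him : i = m
    · subst him
      simp
    · rw [if_neg (by omega), if_neg him]
  simp only [h]
  rw [Finset.sum_ite_eq']
  split_ifs with hm
  · rfl
  · rw [homogeneousComponent_eq_zero m f (by rw [Finset.mem_range] at hm; omega), zero_mul]

theorem coeff_eq_zero_of_mul_mem_pow_idealOfVars [IsDomain R] {f a : MvPolynomial σ R} {K N : ℕ}
    (ha : a.IsHomogeneous K) (ha0 : a ≠ 0) (h : f * a ∈ idealOfVars σ R ^ (N + 1 + K))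
    {d : σ →₀ ℕ} (hd : d.degree ≤ N) : coeff d f = 0 := by
  have h0 : homogeneousComponent (d.degree + K) (f * a) = 0 := by
    ext e
    rw [coeff_homogeneousComponent, coeff_zero]
    split_ifs with he
    · exact (mem_pow_idealOfVars_iff' _ _).1 h e (by omega)
    · rfl
  rw [homogeneousComponent_mul_of_isHomogeneous ha] at h0
  have h1 := (mul_eq_zero.1 h0).resolve_right ha0
  simpa [coeff_homogeneousComponent] using congrArg (coeff d) h1

end Homogeneous

theorem isHomogeneous_alternant_X {R : Type*} [CommRing R] {n : ℕ} (e : Fin n → ℕ) :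
    (alternant (X : Fin n → MvPolynomial (Fin n) R) e).IsHomogeneous (∑ j, e j) := by
  unfold alternant
  rw [Matrix.det_apply]
  refine IsHomogeneous.sum _ _ _ fun σ _ => ?_
  rw [Units.smul_def, ← Int.cast_smul_eq_zsmul R, smul_eq_C_mul]
  exact (IsHomogeneous.prod _ _ _ fun j _ => isHomogeneous_X_pow _ _).C_mul _

theorem alternant_staircase_X_ne_zero {R : Type*} [CommRing R] [IsDomain R] (n : ℕ) :
    alternant (X : Fin n → MvPolynomial (Fin n) R) (fun j => n - 1 - j) ≠ 0 := by
  have h : (fun j : Fin n => n - 1 - (j : ℕ)) = (fun j : Fin n => (j : ℕ)) ∘ Fin.revPerm := by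
    funext j
    simp only [Function.comp_apply, Fin.revPerm_apply, Fin.val_rev]
    omega
  rw [h, alternant_comp_perm]
  refine mul_ne_zero ?_ (Matrix.det_vandermonde_ne_zero_iff.2 X_injective)
  rcases Int.units_eq_one_or (Equiv.Perm.sign (Fin.revPerm : Equiv.Perm (Fin n))) with h | h <;>
    simp [h]

theorem parabosonic_identity (n p : ℕ) (d : Fin n →₀ ℕ) :
    MvPolynomial.coeff d
      (∑ f : {f : Fin n → Fin (n + 1) // IsSCBox n f},
        ((-1 : MvPolynomial (Fin n) ℤ) ^
            ((psize (extN fun i => ((f : Fin n → Fin (n + 1)) i : ℕ)) +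
              prank (extN fun i => ((f : Fin n → Fin (n + 1)) i : ℕ))) / 2)) *
          schur n (conjAugP p (extN fun i => ((f : Fin n → Fin (n + 1)) i : ℕ)))) =
    ∑ g : {g : Fin p → Fin ((d.sum fun _ v => v) + 1) // Antitone g},
      MvPolynomial.coeff d
        (schur n (extN fun i => ((g : Fin p → Fin ((d.sum fun _ v => v) + 1)) i : ℕ)) *
          (∏ i : Fin n, (1 - X i)) *
          ∏ q ∈ Finset.univ.filter (fun q : Fin n × Fin n => q.1 < q.2),
            (1 - X q.1 * X q.2)) := by
  have hx : ∀ i, (X i : MvPolynomial (Fin n) ℤ) ∈ idealOfVars (Fin n) ℤ := fun i =>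
    Ideal.subset_span ⟨i, rfl⟩
  have hx1 : ∀ i, (1 + X i : MvPolynomial (Fin n) ℤ) ≠ 0 := fun i h => by
    simpa using congrArg constantCoeff h
  have h := boundedSum_mul_littlewoodProd_sub_mem (d.sum fun _ v => v) n p X hx hx1
  rw [← sum_schur_mul_alternant, ← sum_selfConj_mul_alternant, mul_right_comm, ← sub_mul] at h
  have h0 := coeff_eq_zero_of_mul_mem_pow_idealOfVars (isHomogeneous_alternant_X _)
    (alternant_staircase_X_ne_zero n) h (le_refl d.degree)
  rw [coeff_sub, sub_eq_zero] at h0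
  rw [← h0, littlewoodProd, Finset.sum_mul, coeff_sum]
  exact Finset.sum_congr rfl fun g _ => by rw [mul_assoc]
end
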